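/- (Fundamental Morita theorem for Hilbert modules.) Let A and B be m-regular involutive quantales. Then A and B are Morita equivalent if and only if there exist an essential right Hilbert A–B bimodule X and an essential right Hilbert B–A bimodule Y such that X⊗̇_B Y ≅ A and Y⊗̇_A X ≅ B as bimodules. -/

import Mathlib

universe u v w

set_option autoImplicit false

/-- An involutive quantale: a complete lattice with an associative multiplication
distributing over arbitrary joins in both arguments, together with an involution. -/
class InvQuantale (A : Type u) extends CompleteLattice A, Mul A, Star A where
  qmul_assoc : ∀ a b c : A, a * b * c = a * (b * c)
  mul_sSup : ∀ (a : A) (S : Set A), a * sSup S = ⨆ b ∈ S, a * b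
  sSup_mul : ∀ (S : Set A) (a : A), sSup S * a = ⨆ b ∈ S, b * a
  qstar_star : ∀ a : A, star (star a) = a
  star_sSup : ∀ S : Set A, star (sSup S) = ⨆ a ∈ S, star a
  qstar_mul : ∀ a b : A, star (a * b) = star b * star a

namespace Quantale

variable {A : Type u} [InvQuantale A]

theorem mul_iSup {ι : Sort w} (a : A) (f : ι → A) :
    (a * ⨆ i, f i) = ⨆ i, a * f i := by
  rw [iSup, InvQuantale.mul_sSup, iSup_range]

theorem iSup_mul {ι : Sort w} (f : ι → A) (a : A) :
    (⨆ i, f i) * a = ⨆ i, f i * a := by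
  rw [iSup, InvQuantale.sSup_mul, iSup_range]

theorem star_iSup {ι : Sort w} (f : ι → A) :
    star (⨆ i, f i) = ⨆ i, star (f i) := by
  rw [iSup, InvQuantale.star_sSup, iSup_range]

end Quantale

/-- A quantale is unital if it has a two-sided unit for the multiplication. -/
def InvQuantale.IsUnital (A : Type u) [InvQuantale A] : Prop :=
  ∃ e : A, ∀ a : A, e * a = a ∧ a * e = a
section Modules

/-- A right module over an involutive quantale. -/
class QMod (A : Type u) [InvQuantale A] (M : Type v) [CompleteLattice M] where
  act : M → A → M
  act_mul : ∀ (m : M) (a b : A), act m (a * b) = act (act m a) b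
  sSup_act : ∀ (S : Set M) (a : A), act (sSup S) a = ⨆ m ∈ S, act m a
  act_sSup : ∀ (m : M) (S : Set A), act m (sSup S) = ⨆ a ∈ S, act m a

/-- The module action `m ⋄ a`. -/
abbrev qact {A : Type u} [InvQuantale A] {M : Type v} [CompleteLattice M] [QMod A M]
    (m : M) (a : A) : M := QMod.act m a

/-- A right pre-Hilbert module over an involutive quantale. -/
class QPreHilb (A : Type u) [InvQuantale A] (M : Type v) [CompleteLattice M] extends
    QMod A M where
  ip : M → M → A
  ip_mul : ∀ (m n : M) (a : A), ip m n * a = ip m (act n a)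
  sSup_ip : ∀ (S : Set M) (n : M), ip (sSup S) n = ⨆ m ∈ S, ip m n
  ip_sSup : ∀ (m : M) (S : Set M), ip m (sSup S) = ⨆ n ∈ S, ip m n
  star_ip : ∀ m n : M, star (ip m n) = ip n m

/-- The inner product `⟨m, n⟩` with values in `A`. -/
abbrev qip (A : Type u) [InvQuantale A] {M : Type v} [CompleteLattice M] [QPreHilb A M]
    (m n : M) : A := QPreHilb.ip m n

/-- A right Hilbert module: a pre-Hilbert module whose inner product separates points. -/
class QHilb (A : Type u) [InvQuantale A] (M : Type v) [CompleteLattice M] extends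
    QPreHilb A M where
  ip_sep : ∀ m n : M, (∀ p : M, ip p m = ip p n) → m = n

variable {A : Type u} [InvQuantale A]

theorem qact_iSup_left {M : Type v} [CompleteLattice M] [QMod A M] {ι : Sort w}
    (f : ι → M) (a : A) : qact (⨆ i, f i) a = ⨆ i, qact (f i) a := by
  rw [iSup]; exact (QMod.sSup_act _ _).trans iSup_range

theorem qact_iSup_right {M : Type v} [CompleteLattice M] [QMod A M] {ι : Sort w}
    (m : M) (f : ι → A) : qact m (⨆ i, f i) = ⨆ i, qact m (f i) := by
  rw [iSup]; exact (QMod.act_sSup _ _).trans iSup_range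

theorem qip_iSup_left {M : Type v} [CompleteLattice M] [QPreHilb A M] {ι : Sort w}
    (f : ι → M) (n : M) : qip A (⨆ i, f i) n = ⨆ i, qip A (f i) n := by
  rw [iSup]; exact (QPreHilb.sSup_ip _ _).trans iSup_range

theorem qip_iSup_right {M : Type v} [CompleteLattice M] [QPreHilb A M] {ι : Sort w}
    (m : M) (f : ι → M) : qip A m (⨆ i, f i) = ⨆ i, qip A m (f i) := by
  rw [iSup]; exact (QPreHilb.ip_sSup _ _).trans iSup_range

/-- A module is essential if every element is a join of elements of the form `m ⋄ a`. -/
def Essential (A : Type u) [InvQuantale A] (M : Type v) [CompleteLattice M] [QMod A M] :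
    Prop :=
  ∀ m : M, m = sSup {x : M | (∃ (p : M) (a : A), x = qact p a) ∧ x ≤ m}

/-- A module is separated by `A` if the right actions separate points. -/
def Separated (A : Type u) [InvQuantale A] (M : Type v) [CompleteLattice M] [QMod A M] :
    Prop :=
  ∀ m n : M, (∀ a : A, qact m a = qact n a) → m = n

/-- A module is m-regular if it is essential and separated. -/
def MRegMod (A : Type u) [InvQuantale A] (M : Type v) [CompleteLattice M] [QMod A M] :
    Prop :=
  Essential A M ∧ Separated A M

/-- A pre-Hilbert module is full if every element of `A` is a join of inner products. -/
def FullMod (A : Type u) [InvQuantale A] (M : Type v) [CompleteLattice M] [QPreHilb A M] :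
    Prop :=
  ∀ a : A, a = sSup {b : A | (∃ m n : M, b = qip A m n) ∧ b ≤ a}

/-- An involutive quantale with multiplication as right action on itself. -/
instance selfQMod : QMod A A where
  act m a := m * a
  act_mul m a b := (InvQuantale.qmul_assoc m a b).symm
  sSup_act S a := InvQuantale.sSup_mul S a
  act_sSup m S := InvQuantale.mul_sSup m S

/-- An involutive quantale as a pre-Hilbert module over itself, with `⟨a, b⟩ = a⋆ · b`. -/
instance selfQPreHilb : QPreHilb A A where
  ip a b := star a * b
  ip_mul m n a := InvQuantale.qmul_assoc _ _ _
  sSup_ip S n := by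
    show star (sSup S) * n = ⨆ m ∈ S, star m * n
    rw [InvQuantale.star_sSup]
    simp only [Quantale.iSup_mul]
  ip_sSup m S := InvQuantale.mul_sSup _ S
  star_ip m n := by
    rw [InvQuantale.qstar_mul, InvQuantale.qstar_star]

/-- An involutive quantale is m-regular if it is m-regular as a right module over itself. -/
def InvQuantale.MReg (A : Type u) [InvQuantale A] : Prop := MRegMod A A

/-- If right multiplications separate the points of `A`, then `A` is a right Hilbert module
over itself. -/
def selfQHilb (hsep : ∀ a b : A, (∀ c : A, a * c = b * c) → a = b) : QHilb A A where
  toQPreHilb := selfQPreHilb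
  ip_sep := by
    intro m n h
    have h2 : ∀ c : A, star m * c = star n * c := by
      intro c
      have h1 : star c * m = star c * n := h c
      have h3 := congrArg star h1
      rw [InvQuantale.qstar_mul, InvQuantale.qstar_mul, InvQuantale.qstar_star] at h3
      exact h3
    have h4 := hsep _ _ h2
    have h5 := congrArg star h4
    rwa [InvQuantale.qstar_star, InvQuantale.qstar_star] at h5

end Modules
section Pi

variable {A : Type u} [InvQuantale A]

/-- Pointwise right module structure on a power of a module. -/
instance piQMod (J : Type w) (M : Type v) [CompleteLattice M] [QMod A M] :
    QMod A (J → M) where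
  act v a := fun j => qact (v j) a
  act_mul v a b := funext fun j => QMod.act_mul (v j) a b
  sSup_act S a := by
    funext j
    show qact (sSup S j) a = _
    rw [sSup_apply, qact_iSup_left, iSup_subtype]
    simp only [iSup_apply]
  act_sSup v S := by
    funext j
    show qact (v j) (sSup S) = _
    rw [show qact (v j) (sSup S) = ⨆ a ∈ S, qact (v j) a from QMod.act_sSup _ _]
    simp only [iSup_apply]

/-- Pointwise pre-Hilbert structure on a power of a pre-Hilbert module, with inner product
`⟨v, w⟩ = ⨆ j, ⟨v j, w j⟩`.  In particular `A^J` carries the inner product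
`⟨(a_j), (b_j)⟩ = ⨆ j, a_j⋆ · b_j`. -/
instance piQPreHilb (J : Type w) (M : Type v) [CompleteLattice M] [QPreHilb A M] :
    QPreHilb A (J → M) where
  ip v w := ⨆ j, qip A (v j) (w j)
  ip_mul v w a := by
    show (⨆ j, qip A (v j) (w j)) * a = ⨆ j, qip A (v j) (qact (w j) a)
    rw [Quantale.iSup_mul]
    exact iSup_congr fun j => QPreHilb.ip_mul _ _ _
  sSup_ip S w := by
    show (⨆ j, qip A (sSup S j) (w j)) = ⨆ v ∈ S, ⨆ j, qip A (v j) (w j)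
    calc (⨆ j, qip A (sSup S j) (w j))
        = ⨆ j, ⨆ f : S, qip A ((f : J → M) j) (w j) := by
          refine iSup_congr fun j => ?_
          rw [sSup_apply, qip_iSup_left]
      _ = ⨆ f : S, ⨆ j, qip A ((f : J → M) j) (w j) := iSup_comm
      _ = ⨆ v ∈ S, ⨆ j, qip A (v j) (w j) := by rw [iSup_subtype]
  ip_sSup v S := by
    show (⨆ j, qip A (v j) (sSup S j)) = ⨆ w ∈ S, ⨆ j, qip A (v j) (w j)
    calc (⨆ j, qip A (v j) (sSup S j))
        = ⨆ j, ⨆ f : S, qip A (v j) ((f : J → M) j) := by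
          refine iSup_congr fun j => ?_
          rw [sSup_apply, qip_iSup_right]
      _ = ⨆ f : S, ⨆ j, qip A (v j) ((f : J → M) j) := iSup_comm
      _ = ⨆ w ∈ S, ⨆ j, qip A (v j) (w j) := by rw [iSup_subtype]
  star_ip v w := by
    show star (⨆ j, qip A (v j) (w j)) = ⨆ j, qip A (w j) (v j)
    rw [Quantale.star_iSup]
    exact iSup_congr fun j => QPreHilb.star_ip _ _

end Pi

section Maps

variable {A : Type u} [InvQuantale A]

/-- A module homomorphism: a join-preserving map commuting with the action. -/
def IsModHom (A : Type u) [InvQuantale A] {M : Type v} {N : Type w}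
    [CompleteLattice M] [CompleteLattice N] [QMod A M] [QMod A N] (f : M → N) : Prop :=
  (∀ S : Set M, f (sSup S) = ⨆ m ∈ S, f m) ∧ ∀ (m : M) (a : A), f (qact m a) = qact (f m) a

/-- `g` is a ⋆-adjoint of `f`: `⟨f m, n⟩ = ⟨m, g n⟩`. -/
def IsAdjointPair (A : Type u) [InvQuantale A] {M : Type v} {N : Type w}
    [CompleteLattice M] [CompleteLattice N] [QPreHilb A M] [QPreHilb A N]
    (f : M → N) (g : N → M) : Prop :=
  ∀ (m : M) (n : N), qip A (f m) n = qip A m (g n)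

/-- A map between (pre-)Hilbert modules is adjointable if it has a ⋆-adjoint. -/
def Adjointable (A : Type u) [InvQuantale A] {M : Type v} {N : Type w}
    [CompleteLattice M] [CompleteLattice N] [QPreHilb A M] [QPreHilb A N]
    (f : M → N) : Prop :=
  ∃ g : N → M, IsAdjointPair A f g

theorem IsAdjointPair.symm' {M : Type v} {N : Type w}
    [CompleteLattice M] [CompleteLattice N] [QPreHilb A M] [QPreHilb A N]
    {f : M → N} {g : N → M} (h : IsAdjointPair A f g) : IsAdjointPair A g f := by
  intro n m
  calc qip A (g n) m = star (qip A m (g n)) := (QPreHilb.star_ip m (g n)).symm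
    _ = star (qip A (f m) n) := by rw [h m n]
    _ = qip A n (f m) := QPreHilb.star_ip _ _

/-- The rank-one operator `Θ_{n,m} : x ↦ n ⋄ ⟨m, x⟩`. -/
def theta (A : Type u) [InvQuantale A] {M : Type v} {N : Type w}
    [CompleteLattice M] [CompleteLattice N] [QPreHilb A M] [QPreHilb A N]
    (n : N) (m : M) : M → N :=
  fun x => qact n (qip A m x)

/-- A compact operator: an arbitrary (pointwise) join of rank-one operators `Θ_{n,m}`. -/
def IsCompactOp (A : Type u) [InvQuantale A] {M : Type v} {N : Type w}
    [CompleteLattice M] [CompleteLattice N] [QPreHilb A M] [QPreHilb A N]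
    (f : M → N) : Prop :=
  ∃ S : Set (N × M), ∀ x : M, f x = ⨆ p ∈ S, theta A p.1 p.2 x

end Maps

section LeftModules

/-- A left module over an involutive quantale. -/
class QLMod (A : Type u) [InvQuantale A] (M : Type v) [CompleteLattice M] where
  lact : A → M → M
  lact_mul : ∀ (a b : A) (m : M), lact (a * b) m = lact a (lact b m)
  sSup_lact : ∀ (S : Set A) (m : M), lact (sSup S) m = ⨆ a ∈ S, lact a m
  lact_sSup : ∀ (a : A) (S : Set M), lact a (sSup S) = ⨆ m ∈ S, lact a m

/-- A left pre-Hilbert module over an involutive quantale. -/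
class QLPreHilb (A : Type u) [InvQuantale A] (M : Type v) [CompleteLattice M] extends
    QLMod A M where
  lip : M → M → A
  lip_lact : ∀ (a : A) (m n : M), a * lip m n = lip (lact a m) n
  sSup_lip : ∀ (S : Set M) (n : M), lip (sSup S) n = ⨆ m ∈ S, lip m n
  lip_sSup : ∀ (m : M) (S : Set M), lip m (sSup S) = ⨆ n ∈ S, lip m n
  star_lip : ∀ m n : M, star (lip m n) = lip n m

/-- A left Hilbert module. -/
class QLHilb (A : Type u) [InvQuantale A] (M : Type v) [CompleteLattice M] extends
    QLPreHilb A M where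
  lip_sep : ∀ m n : M, (∀ p : M, lip m p = lip n p) → m = n

/-- A left module is essential if every element is a join of elements `a • m`. -/
def LEssential (A : Type u) [InvQuantale A] (M : Type v) [CompleteLattice M] [QLMod A M] :
    Prop :=
  ∀ m : M, m = sSup {x : M | (∃ (a : A) (p : M), x = QLMod.lact a p) ∧ x ≤ m}

/-- A left module is separated by `A` if the left actions separate points. -/
def LSeparated (A : Type u) [InvQuantale A] (M : Type v) [CompleteLattice M] [QLMod A M] :
    Prop :=
  ∀ m n : M, (∀ a : A, QLMod.lact a m = QLMod.lact a n) → m = n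

/-- A left pre-Hilbert module is full if every element of `A` is a join of inner products. -/
def LFull (A : Type u) [InvQuantale A] (M : Type v) [CompleteLattice M] [QLPreHilb A M] :
    Prop :=
  ∀ a : A, a = sSup {b : A | (∃ m n : M, b = QLPreHilb.lip m n) ∧ b ≤ a}

end LeftModules
open CategoryTheory

section Categories

variable {A : Type u} [InvQuantale A]

/-- An object of the category `mreg-Hilb_A` (or `mreg-HMOD_A`): an m-regular right
Hilbert `A`-module. -/
structure HObj (A : Type u) [InvQuantale A] : Type (u + 1) where
  carrier : Type u
  [lat : CompleteLattice carrier]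
  [str : QHilb A carrier]
  ess : Essential A carrier
  sep : Separated A carrier

attribute [instance] HObj.lat HObj.str

instance : CoeSort (HObj A) (Type u) := ⟨HObj.carrier⟩

/-- The category `mreg-Hilb_A` of m-regular right Hilbert `A`-modules with
adjointable maps as morphisms. -/
instance HObj.cat : Category.{u} (HObj A) where
  Hom M N := {f : M.carrier → N.carrier // Adjointable A f}
  id M := ⟨fun m => m, ⟨fun m => m, fun _ _ => rfl⟩⟩
  comp {M N P} f g := ⟨fun m => g.1 (f.1 m), by
    obtain ⟨f', hf⟩ := f.2
    obtain ⟨g', hg⟩ := g.2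
    exact ⟨fun p => f' (g' p), fun m p => (hg (f.1 m) p).trans (hf m (g' p))⟩⟩
  id_comp f := Subtype.ext rfl
  comp_id f := Subtype.ext rfl
  assoc f g h := Subtype.ext rfl

/-- Construct a morphism of `mreg-Hilb_A`. -/
def mkHom {M N : HObj A} (f : M.carrier → N.carrier) (hf : Adjointable A f) : M ⟶ N :=
  ⟨f, hf⟩

/-- The underlying function of a morphism. -/
def homFn {M N : HObj A} (f : M ⟶ N) : M.carrier → N.carrier := f.1

/-- The ⋆-adjoint of a morphism of `mreg-Hilb_A`. -/
noncomputable def hStar {M N : HObj A} (f : M ⟶ N) : N ⟶ M :=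
  ⟨Classical.choose f.2, ⟨f.1, (Classical.choose_spec f.2).symm'⟩⟩

theorem hStar_adj {M N : HObj A} (f : M ⟶ N) : IsAdjointPair A f.1 (hStar f).1 :=
  Classical.choose_spec f.2

/-- The join of a set of morphisms of `mreg-Hilb_A`, computed pointwise. -/
noncomputable def hSup {M N : HObj A} (S : Set (M ⟶ N)) : M ⟶ N :=
  ⟨fun m => ⨆ f ∈ S, (f : M ⟶ N).1 m,
   ⟨fun n => ⨆ f ∈ S, (hStar f).1 n, by
      intro m n
      have L : qip A (⨆ f ∈ S, (f : M ⟶ N).1 m) n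
          = ⨆ f ∈ S, qip A ((f : M ⟶ N).1 m) n := by
        rw [qip_iSup_left]
        exact iSup_congr fun f => qip_iSup_left _ _
      have R : qip A m (⨆ f ∈ S, (hStar f).1 n)
          = ⨆ f ∈ S, qip A m ((hStar f).1 n) := by
        rw [qip_iSup_right]
        exact iSup_congr fun f => qip_iSup_right _ _
      rw [L, R]
      exact iSup_congr fun f => iSup_congr fun _ => hStar_adj f m n⟩⟩

/-- A morphism is unitary if its ⋆-adjoint is a two-sided inverse. -/
noncomputable def IsUnitaryHom {M N : HObj A} (f : M ⟶ N) : Prop :=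
  f ≫ hStar f = 𝟙 M ∧ hStar f ≫ f = 𝟙 N

end Categories

section Functors

/-- A (join-preserving) ⋆-functor between the categories `mreg-Hilb_A` and `mreg-Hilb_B`. -/
structure StarFunctor (A B : Type u) [InvQuantale A] [InvQuantale B] : Type (u + 1) where
  toFunctor : HObj A ⥤ HObj B
  map_star : ∀ {M N : HObj A} (f : M ⟶ N),
    toFunctor.map (hStar f) = hStar (toFunctor.map f)
  map_hSup : ∀ {M N : HObj A} (S : Set (M ⟶ N)),
    toFunctor.map (hSup S) = hSup (toFunctor.map '' S)

/-- Morita equivalence of involutive quantales: there are ⋆-functors `F, G` between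
`mreg-Hilb_A` and `mreg-Hilb_B` with `GF ≅ Id` and `FG ≅ Id` via unitary natural
isomorphisms. -/
def Morita (A B : Type u) [InvQuantale A] [InvQuantale B] : Prop :=
  ∃ (F : StarFunctor A B) (G : StarFunctor B A)
    (η : F.toFunctor ⋙ G.toFunctor ⟶ 𝟭 (HObj A))
    (ζ : G.toFunctor ⋙ F.toFunctor ⟶ 𝟭 (HObj B)),
    (∀ M : HObj A, IsUnitaryHom (η.app M)) ∧ (∀ N : HObj B, IsUnitaryHom (ζ.app N))

variable {A : Type u} [InvQuantale A]

/-- An m-regular involutive quantale as an object of `mreg-Hilb_A`. -/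
def selfObj (A : Type u) [InvQuantale A] (hA : InvQuantale.MReg A) : HObj A where
  carrier := A
  lat := inferInstance
  str := selfQHilb hA.2
  ess := hA.1
  sep := hA.2

/-- Left multiplication by `a` as a morphism `A ⟶ A` of `mreg-Hilb_A`. -/
def lmulHom (A : Type u) [InvQuantale A] (hA : InvQuantale.MReg A) (a : A) :
    selfObj A hA ⟶ selfObj A hA :=
  ⟨fun (b : A) => a * b, ⟨fun (b : A) => Star.star a * b, fun (m n : A) => by
    show Star.star (a * m) * n = Star.star m * (Star.star a * n)
    rw [InvQuantale.qstar_mul, InvQuantale.qmul_assoc]⟩⟩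

/-- The left `A`-action `a • z = F(L_a)(z)` on `Z = F(A)` used in the Eilenberg-Watts
theorem. -/
def EWact {A B : Type u} [InvQuantale A] [InvQuantale B] (hA : InvQuantale.MReg A)
    (F : StarFunctor A B) :
    A → (F.toFunctor.obj (selfObj A hA)).carrier → (F.toFunctor.obj (selfObj A hA)).carrier :=
  fun a z => (F.toFunctor.map (lmulHom A hA a)).1 z

end Functors
section Bimodules

/-- A right Hilbert `A`–`B` bimodule structure: `M` is a right Hilbert `B`-module with a
compatible left `A`-action. -/
structure IsRightHilbBimod (A B : Type u) [InvQuantale A] [InvQuantale B]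
    (M : Type u) [CompleteLattice M] [QHilb B M] (lact : A → M → M) : Prop where
  lact_mul : ∀ (a b : A) (m : M), lact (a * b) m = lact a (lact b m)
  sSup_lact : ∀ (S : Set A) (m : M), lact (sSup S) m = ⨆ a ∈ S, lact a m
  lact_sSup : ∀ (a : A) (S : Set M), lact a (sSup S) = ⨆ m ∈ S, lact a m
  lact_act : ∀ (a : A) (x : M) (b : B), lact a (qact x b) = qact (lact a x) b
  ip_lact : ∀ (a : A) (x y : M), qip B (lact a x) y = qip B x (lact (Star.star a) y)

/-- A left action is essential if every element is a join of elements `a • m`. -/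
def LEssentialAct {A : Type u} {M : Type u} [CompleteLattice M] (lact : A → M → M) : Prop :=
  ∀ m : M, m = sSup {x : M | (∃ (a : A) (p : M), x = lact a p) ∧ x ≤ m}

/-- `t : M × N → P` realizes `P` as the interior tensor product `M ⊗̇_A N` of the right
Hilbert `A`-module `M` with the right Hilbert `A`–`B` bimodule `N` (with left action
`lactN`): `t` is bilinear for joins, its image join-generates `P`, and
`⟨x₁ ⊗ y₁, x₂ ⊗ y₂⟩ = ⟨y₁, ⟨x₁,x₂⟩ • y₂⟩`. -/
structure IsInteriorTensor (A B : Type u) [InvQuantale A] [InvQuantale B]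
    {M : Type u} [CompleteLattice M] [QHilb A M]
    {N : Type u} [CompleteLattice N] [QHilb B N] (lactN : A → N → N)
    {P : Type u} [CompleteLattice P] [QHilb B P]
    (t : M → N → P) : Prop where
  ip_t : ∀ (x₁ x₂ : M) (y₁ y₂ : N),
    qip B (t x₁ y₁) (t x₂ y₂) = qip B y₁ (lactN (qip A x₁ x₂) y₂)
  sSup_t : ∀ (S : Set M) (y : N), t (sSup S) y = ⨆ x ∈ S, t x y
  t_sSup : ∀ (x : M) (S : Set N), t x (sSup S) = ⨆ y ∈ S, t x y
  gen : ∀ p : P, p = sSup {q : P | (∃ x y, q = t x y) ∧ q ≤ p}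

/-- A bundled right Hilbert `A`-module. -/
structure HilbMod (A : Type u) [InvQuantale A] : Type (u + 1) where
  carrier : Type u
  [lat : CompleteLattice carrier]
  [str : QHilb A carrier]

attribute [instance] HilbMod.lat HilbMod.str

/-- A bundled right Hilbert `A`–`B` bimodule. -/
structure BimodObj (A B : Type u) [InvQuantale A] [InvQuantale B] : Type (u + 1) where
  carrier : Type u
  [lat : CompleteLattice carrier]
  [str : QHilb B carrier]
  lact : A → carrier → carrier
  bimod : IsRightHilbBimod A B carrier lact

attribute [instance] BimodObj.lat BimodObj.str

/-- An imprimitivity `A`–`B` bimodule structure on `X`: a full m-regular right Hilbert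
`B`-module and full m-regular left Hilbert `A`-module with compatible structures. -/
structure IsImprim (A B : Type u) [InvQuantale A] [InvQuantale B]
    (X : Type u) [CompleteLattice X] [QHilb B X]
    (lact : A → X → X) (lip : X → X → A) : Prop where
  bimod : IsRightHilbBimod A B X lact
  lip_lact : ∀ (a : A) (x y : X), a * lip x y = lip (lact a x) y
  sSup_lip : ∀ (S : Set X) (y : X), lip (sSup S) y = ⨆ x ∈ S, lip x y
  lip_sSup : ∀ (x : X) (S : Set X), lip x (sSup S) = ⨆ y ∈ S, lip x y
  star_lip : ∀ x y : X, Star.star (lip x y) = lip y x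
  lip_sep : ∀ x y : X, (∀ z : X, lip x z = lip y z) → x = y
  rfull : ∀ b : B, b = sSup {c : B | (∃ x y : X, c = qip B x y) ∧ c ≤ b}
  lfull : ∀ a : A, a = sSup {c : A | (∃ x y : X, c = lip x y) ∧ c ≤ a}
  ress : Essential B X
  rsep : Separated B X
  less : LEssentialAct lact
  lsep : ∀ m n : X, (∀ a : A, lact a m = lact a n) → m = n
  imp1 : ∀ x y z : X, lact (lip x y) z = qact x (qip B y z)
  imp2 : ∀ (x y : X) (b : B), lip (qact x b) y = lip x (qact y (Star.star b))

/-- A bundled imprimitivity `A`–`B` bimodule; `A` and `B` are strongly Morita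
equivalent iff such a bimodule exists. -/
structure ImprimObj (A B : Type u) [InvQuantale A] [InvQuantale B] : Type (u + 1) where
  carrier : Type u
  [lat : CompleteLattice carrier]
  [str : QHilb B carrier]
  lact : A → carrier → carrier
  lip : carrier → carrier → A
  imprim : IsImprim A B carrier lact lip

attribute [instance] ImprimObj.lat ImprimObj.str

end Bimodules

section Constructions

/-- The opposite involutive quantale `A^d`, with multiplication `a ∘ b = b · a`. -/
def InvQuantale.dual (A : Type u) [iq : InvQuantale A] : InvQuantale A :=
  { iq.toCompleteLattice with
    mul := fun a b => b * a
    star := fun a => Star.star a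
    qmul_assoc := fun a b c => (InvQuantale.qmul_assoc c b a).symm
    mul_sSup := fun a S => InvQuantale.sSup_mul S a
    sSup_mul := fun S a => InvQuantale.mul_sSup a S
    qstar_star := fun a => InvQuantale.qstar_star a
    star_sSup := fun S => InvQuantale.star_sSup S
    qstar_mul := fun a b => InvQuantale.qstar_mul b a }

/-- The involutive quantale of `J × J` matrices over `A`, with matrix multiplication
(joins in place of sums) and conjugate-transpose involution. -/
def MatrixQuantale (A : Type u) [InvQuantale A] (J : Type u) :
    InvQuantale (J → J → A) :=
  { (inferInstance : CompleteLattice (J → J → A)) with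
    mul := fun X Y i k => ⨆ j, X i j * Y j k
    star := fun X i j => Star.star (X j i)
    qmul_assoc := by
      intro X Y Z
      funext i l
      show (⨆ k, (⨆ j, X i j * Y j k) * Z k l) = ⨆ j, X i j * ⨆ k, Y j k * Z k l
      calc (⨆ k, (⨆ j, X i j * Y j k) * Z k l)
          = ⨆ k, ⨆ j, (X i j * Y j k) * Z k l := by
            exact iSup_congr fun k => Quantale.iSup_mul _ _
        _ = ⨆ j, ⨆ k, X i j * (Y j k * Z k l) := by
            rw [iSup_comm]
            exact iSup_congr fun j => iSup_congr fun k => InvQuantale.qmul_assoc _ _ _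
        _ = ⨆ j, X i j * ⨆ k, Y j k * Z k l := by
            exact iSup_congr fun j => (Quantale.mul_iSup _ _).symm
    mul_sSup := by
      intro X S
      funext i k
      show (⨆ j, X i j * sSup S j k) = _
      simp only [sSup_apply, iSup_apply, Quantale.mul_iSup]
      rw [iSup_comm]
      rw [iSup_subtype]
      rfl
    sSup_mul := by
      intro S X
      funext i k
      show (⨆ j, sSup S i j * X j k) = _
      simp only [sSup_apply, iSup_apply, Quantale.iSup_mul]
      rw [iSup_comm]
      rw [iSup_subtype]
      rfl
    qstar_star := by
      intro X
      funext i j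
      exact InvQuantale.qstar_star _
    star_sSup := by
      intro S
      funext i j
      show Star.star (sSup S j i) = _
      simp only [sSup_apply, iSup_apply, Quantale.star_iSup]
      rw [iSup_subtype]
    qstar_mul := by
      intro X Y
      funext i l
      show Star.star (⨆ j, X l j * Y j i) = ⨆ j, Star.star (Y j i) * Star.star (X l j)
      rw [Quantale.star_iSup]
      exact iSup_congr fun j => InvQuantale.qstar_mul _ _ }

/-- The property of belonging to the centre of `A`: a join-preserving bimodule
endomorphism that is adjointable for the right and left inner products. -/
def IsCen (A : Type u) [InvQuantale A] (f : A → A) : Prop :=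
  (∀ S : Set A, f (sSup S) = ⨆ a ∈ S, f a) ∧
  (∀ a b : A, f (a * b) = f a * b) ∧
  (∀ a b : A, f (a * b) = a * f b) ∧
  Adjointable A f ∧
  (∃ g : A → A, ∀ a b : A, f a * Star.star b = a * Star.star (g b))

/-- The centre of an m-regular involutive quantale. -/
def Cen (A : Type u) [InvQuantale A] : Type u := {f : A → A // IsCen A f}

end Constructions
section MTools
variable {A : Type u} [InvQuantale A]

theorem qmul_bot (a : A) : a * (⊥ : A) = ⊥ := by
  have := InvQuantale.mul_sSup a (∅ : Set A)
  simpa using this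

theorem qbot_mul (a : A) : (⊥ : A) * a = ⊥ := by
  have := InvQuantale.sSup_mul (∅ : Set A) a
  simpa using this

theorem qstar_bot : star (⊥ : A) = ⊥ := by
  have := InvQuantale.star_sSup (∅ : Set A)
  simpa using this

theorem qmul_sup (a b c : A) : a * (b ⊔ c) = a * b ⊔ a * c := by
  rw [sup_eq_iSup, Quantale.mul_iSup, sup_eq_iSup]
  exact iSup_congr fun b => by cases b <;> rfl

theorem qsup_mul (a b c : A) : (a ⊔ b) * c = a * c ⊔ b * c := by
  rw [sup_eq_iSup, Quantale.iSup_mul, sup_eq_iSup]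
  exact iSup_congr fun b => by cases b <;> rfl

theorem qact_bot_left {M : Type v} [CompleteLattice M] [QMod A M] (a : A) :
    qact (⊥ : M) a = ⊥ := by
  have := QMod.sSup_act (A := A) (∅ : Set M) a
  simpa using this

theorem qact_bot_right {M : Type v} [CompleteLattice M] [QMod A M] (m : M) :
    qact m (⊥ : A) = ⊥ := by
  have := QMod.act_sSup (A := A) m ∅
  simpa using this

theorem qip_bot_left {M : Type v} [CompleteLattice M] [QPreHilb A M] (m : M) :
    qip A (⊥ : M) m = ⊥ := by
  have := QPreHilb.sSup_ip (A := A) (∅ : Set M) m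
  simpa using this

theorem qip_bot_right {M : Type v} [CompleteLattice M] [QPreHilb A M] (m : M) :
    qip A m (⊥ : M) = ⊥ := by
  have := QPreHilb.ip_sSup (A := A) m (∅ : Set M)
  simpa using this

theorem qip_sup_left {M : Type v} [CompleteLattice M] [QPreHilb A M] (m n p : M) :
    qip A (m ⊔ n) p = qip A m p ⊔ qip A n p := by
  rw [sup_eq_iSup, qip_iSup_left, sup_eq_iSup]
  exact iSup_congr fun b => by cases b <;> rfl

theorem qip_sup_right {M : Type v} [CompleteLattice M] [QPreHilb A M] (m n p : M) :
    qip A m (n ⊔ p) = qip A m n ⊔ qip A m p := by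
  rw [sup_eq_iSup, qip_iSup_right, sup_eq_iSup]
  exact iSup_congr fun b => by cases b <;> rfl

theorem qip_act_right {M : Type v} [CompleteLattice M] [QPreHilb A M] (m n : M) (a : A) :
    qip A m (qact n a) = qip A m n * a := (QPreHilb.ip_mul m n a).symm

theorem qip_act_left {M : Type v} [CompleteLattice M] [QPreHilb A M] (m n : M) (a : A) :
    qip A (qact m a) n = star a * qip A m n := by
  have h : star (qip A n (qact m a)) = star (qip A n m * a) := by rw [qip_act_right]
  rw [InvQuantale.qstar_mul] at h
  rw [show star (qip A n (qact m a)) = qip A (qact m a) n from QPreHilb.star_ip _ _,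
    show star (qip A n m) = qip A m n from QPreHilb.star_ip _ _] at h
  exact h

theorem qstar_ip {M : Type v} [CompleteLattice M] [QPreHilb A M] (m n : M) :
    star (qip A m n) = qip A n m := QPreHilb.star_ip _ _

theorem qact_act {M : Type v} [CompleteLattice M] [QMod A M] (m : M) (a b : A) :
    qact (qact m a) b = qact m (a * b) := (QMod.act_mul m a b).symm

/-- A family that join-generates a complete lattice. -/
def Gen {I : Type v} {M : Type w} [CompleteLattice M] (p : I → M) : Prop :=
  ∀ m : M, ∃ S : Set I, m = ⨆ i ∈ S, p i

theorem Gen.ip_ext {I : Type v} {M : Type w} [CompleteLattice M] [QHilb A M] {p : I → M}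
    (hp : Gen p) {m n : M} (h : ∀ i, qip A (p i) m = qip A (p i) n) : m = n := by
  apply QHilb.ip_sep (A := A)
  intro q
  obtain ⟨S, rfl⟩ := hp q
  show qip A _ _ = qip A _ _
  simp only [qip_iSup_left, h]

theorem Gen.self {M : Type w} [CompleteLattice M] : Gen (fun m : M => m) :=
  fun m => ⟨{m}, by simp⟩

theorem gen_of_sSup {I : Type v} {M : Type w} [CompleteLattice M] {p : I → M}
    (h : ∀ m, m = sSup {x | (∃ i, x = p i) ∧ x ≤ m}) : Gen p := by
  intro m
  refine ⟨{i | p i ≤ m}, le_antisymm ?_ (iSup₂_le fun i hi => hi)⟩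
  conv_lhs => rw [h m]
  refine sSup_le ?_
  rintro x ⟨⟨i, rfl⟩, hx⟩
  exact le_iSup₂_of_le i hx le_rfl

theorem Gen.sSup_eq {I : Type v} {M : Type w} [CompleteLattice M] {p : I → M}
    (h : Gen p) (m : M) : m = sSup {x | (∃ i, x = p i) ∧ x ≤ m} := by
  refine le_antisymm ?_ (sSup_le fun x hx => hx.2)
  obtain ⟨S, hS⟩ := h m
  conv_lhs => rw [hS]
  refine iSup₂_le fun i hi => le_sSup ⟨⟨i, rfl⟩, ?_⟩
  rw [hS]; exact le_iSup₂_of_le i hi le_rfl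

/-- If every member of a generating family is a join of members of another family,
the other family generates. -/
theorem Gen.trans {I : Type v} {J : Type v} {M : Type w} [CompleteLattice M]
    {p : I → M} {q : J → M} (hp : Gen p) (h : ∀ i, ∃ S : Set J, p i = ⨆ j ∈ S, q j) :
    Gen q := by
  choose S hS using h
  intro m
  obtain ⟨T, rfl⟩ := hp m
  refine ⟨⋃ i ∈ T, S i, ?_⟩
  simp only [iSup_iUnion]
  exact iSup_congr fun i => iSup_congr fun _ => hS i

theorem hom_iSup {M N : HObj A} (f : M ⟶ N) {ι : Sort w} (g : ι → M.carrier) :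
    f.1 (⨆ i, g i) = ⨆ i, f.1 (g i) := by
  apply Gen.ip_ext (A := A) Gen.self
  intro n
  rw [qip_iSup_right]
  have h := (hStar_adj f).symm'
  show qip A n _ = ⨆ i, qip A n _
  rw [← h, qip_iSup_right]
  exact iSup_congr fun i => h _ _

theorem hom_sSup {M N : HObj A} (f : M ⟶ N) (S : Set M.carrier) :
    f.1 (sSup S) = ⨆ m ∈ S, f.1 m := by
  rw [sSup_eq_iSup, hom_iSup]
  exact iSup_congr fun i => hom_iSup f _

theorem hom_bot {M N : HObj A} (f : M ⟶ N) : f.1 ⊥ = ⊥ := by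
  have := hom_sSup f ∅
  simpa using this

theorem hom_sup {M N : HObj A} (f : M ⟶ N) (m n : M.carrier) :
    f.1 (m ⊔ n) = f.1 m ⊔ f.1 n := by
  rw [sup_eq_iSup, hom_iSup, sup_eq_iSup]
  exact iSup_congr fun b => by cases b <;> rfl

theorem hom_mono {M N : HObj A} (f : M ⟶ N) {m n : M.carrier} (h : m ≤ n) :
    f.1 m ≤ f.1 n := by
  rw [← sup_eq_right] at h ⊢
  rw [← hom_sup, h]

theorem hom_act {M N : HObj A} (f : M ⟶ N) (m : M.carrier) (a : A) :
    f.1 (qact m a) = qact (f.1 m) a := by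
  apply Gen.ip_ext (A := A) Gen.self
  intro n
  have h := (hStar_adj f).symm'
  show qip A n _ = qip A n _
  rw [← h, qip_act_right, qip_act_right, h]

theorem hom_ext' {M N : HObj A} {f g : M ⟶ N} (h : ∀ m, f.1 m = g.1 m) : f = g :=
  Subtype.ext (funext h)

theorem Gen.hom_ext {I : Type v} {M N : HObj A} {p : I → M.carrier} (hp : Gen p)
    {f g : M ⟶ N} (h : ∀ i, f.1 (p i) = g.1 (p i)) : f = g := by
  apply hom_ext'
  intro m
  obtain ⟨S, rfl⟩ := hp m
  simp only [hom_iSup, h]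

theorem comp_app {M N P : HObj A} (f : M ⟶ N) (g : N ⟶ P) (m : M.carrier) :
    (f ≫ g).1 m = g.1 (f.1 m) := rfl

theorem id_app {M : HObj A} (m : M.carrier) : (𝟙 M : M ⟶ M).1 m = m := rfl

theorem hSup_app {M N : HObj A} (S : Set (M ⟶ N)) (m : M.carrier) :
    (hSup S).1 m = ⨆ f ∈ S, (f : M ⟶ N).1 m := rfl

theorem hStar_eq {M N : HObj A} {f : M ⟶ N} {g : N ⟶ M}
    (h : ∀ m n, qip A (f.1 m) n = qip A m (g.1 n)) : hStar f = g := by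
  apply hom_ext'
  intro n
  apply Gen.ip_ext (A := A) Gen.self
  intro m
  show qip A m _ = qip A m _
  rw [← h, hStar_adj f]

theorem hStar_hStar {M N : HObj A} (f : M ⟶ N) : hStar (hStar f) = f :=
  hStar_eq (hStar_adj f).symm'

theorem hStar_comp {M N P : HObj A} (f : M ⟶ N) (g : N ⟶ P) :
    hStar (f ≫ g) = hStar g ≫ hStar f :=
  hStar_eq fun m n => by
    rw [comp_app, comp_app]; exact (hStar_adj g _ _).trans (hStar_adj f _ _)

theorem hStar_ip {M N : HObj A} (f : M ⟶ N) (m : M.carrier) (n : N.carrier) :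
    qip A m ((hStar f).1 n) = qip A (f.1 m) n := (hStar_adj f m n).symm

theorem hStar_ip' {M N : HObj A} (f : M ⟶ N) (m : M.carrier) (n : N.carrier) :
    qip A ((hStar f).1 n) m = qip A n (f.1 m) := (hStar_adj f).symm' n m

/-- Adjointable maps from generators. -/
theorem homOfGens {I : Type v} {J : Type w} {M N : HObj A} {p : I → M.carrier}
    {q : J → N.carrier} (hp : Gen p) (hq : Gen q) (α : I → N.carrier) (β : J → M.carrier)
    (h : ∀ i j, qip A (α i) (q j) = qip A (p i) (β j)) :
    ∃ f : M ⟶ N, (∀ i, f.1 (p i) = α i) ∧ (∀ j, (hStar f).1 (q j) = β j) := by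
  choose S hS using hp
  choose T hT using hq
  have hadj : IsAdjointPair A (fun m => ⨆ i ∈ S m, α i) (fun n => ⨆ j ∈ T n, β j) := by
    intro m n
    conv_lhs => rw [hT n]
    conv_rhs => rw [hS m]
    simp only [qip_iSup_left, qip_iSup_right, h]
    
  have key : ∀ m j, qip A (⨆ i ∈ S m, α i) (q j) = qip A m (β j) := by
    intro m j
    conv_rhs => rw [hS m]
    simp only [qip_iSup_left, h]
  have key2 : ∀ i n, qip A (p i) (⨆ j ∈ T n, β j) = qip A (α i) n := by
    intro i n
    conv_rhs => rw [hT n]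
    simp only [qip_iSup_right, h]
  refine ⟨⟨_, ⟨_, hadj⟩⟩, ?_, ?_⟩
  · intro i
    apply Gen.ip_ext (A := A) (p := q) (fun n => ⟨T n, hT n⟩)
    intro j
    show qip A _ _ = qip A _ _
    rw [← qstar_ip, key, ← h, qstar_ip]
  · intro j
    apply Gen.ip_ext (A := A) (p := p) (fun n => ⟨S n, hS n⟩)
    intro i
    show qip A _ _ = qip A _ _
    rw [hStar_ip, ← h]
    show qip A (⨆ i' ∈ S (p i), α i') (q j) = _
    rw [key, h]

/-- An isometry matching generating families is unitary. -/
theorem unitaryOfGens {I : Type v} {M N : HObj A} {p : I → M.carrier}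
    {q : I → N.carrier} (hp : Gen p) (hq : Gen q)
    (h : ∀ i j, qip A (q i) (q j) = qip A (p i) (p j)) :
    ∃ f : M ⟶ N, (∀ i, f.1 (p i) = q i) ∧ IsUnitaryHom f := by
  obtain ⟨f, h1, h2⟩ := homOfGens hp hq q p h
  exact ⟨f, h1, hp.hom_ext fun i => by simp [comp_app, h1, h2, id_app],
    hq.hom_ext fun i => by simp [comp_app, h1, h2, id_app]⟩

theorem HObj.gen (M : HObj A) : Gen (fun x : M.carrier × A => qact x.1 x.2) :=
  gen_of_sSup fun m => by
    have := M.ess m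
    simpa [Prod.exists] using this

end MTools

section MKernel
variable {A : Type u} [InvQuantale A]

/-- Column space of a kernel. -/
def kcol {I : Type u} (k : I → I → A) (S : Set (I × A)) : I → A :=
  fun j => ⨆ x ∈ S, k j x.1 * x.2

@[ext]
structure KCar {I : Type u} (k : I → I → A) : Type u where
  val : I → A
  prop : ∃ S, val = kcol k S

noncomputable def krep {I : Type u} {k : I → I → A} (f : KCar k) : Set (I × A) :=
  Classical.choose f.2

theorem krep_spec {I : Type u} {k : I → I → A} (f : KCar k) : f.1 = kcol k (krep f) :=
  Classical.choose_spec f.2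

theorem kcol_iUnion {I : Type u} (k : I → I → A) {ι : Sort w} (S : ι → Set (I × A)) :
    kcol k (⋃ i, S i) = ⨆ i, kcol k (S i) := by
  funext j
  simp only [kcol, iSup_iUnion, iSup_apply]

noncomputable instance kLat {I : Type u} (k : I → I → A) : CompleteLattice (KCar k) :=
  letI : PartialOrder (KCar k) := PartialOrder.lift KCar.val (fun _ _ h => KCar.ext h)
  letI : SupSet (KCar k) := ⟨fun T => ⟨⨆ f ∈ T, f.1, ⟨⋃ f : T, krep f.1, by
    rw [kcol_iUnion, iSup_subtype]
    exact iSup_congr fun f => iSup_congr fun _ => krep_spec f⟩⟩⟩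
  completeLatticeOfSup (KCar k) (by
    intro T
    constructor
    · intro f hf
      show f.1 ≤ ⨆ f ∈ T, f.1
      exact le_iSup₂_of_le f hf le_rfl
    · intro g hg
      show ⨆ f ∈ T, f.1 ≤ g.1
      exact iSup₂_le fun f hf => hg hf)

theorem kLat_sSup {I : Type u} {k : I → I → A} (T : Set (KCar k)) :
    (sSup T).1 = ⨆ f ∈ T, f.1 := rfl

theorem kLat_iSup {I : Type u} {k : I → I → A} {ι : Sort w} (f : ι → KCar k) :
    (⨆ i, f i).1 = ⨆ i, (f i).1 := by
  rw [iSup, kLat_sSup, iSup_range]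

/-- The inner product of a column with representation `S` with a column `g`. -/
def kpair {I : Type u} (S : Set (I × A)) (g : I → A) : A :=
  ⨆ x ∈ S, star x.2 * g x.1

theorem kpair_symm {I : Type u} {k : I → I → A} (hk : ∀ i j, star (k i j) = k j i)
    (S T : Set (I × A)) : star (kpair S (kcol k T)) = kpair T (kcol k S) := by
  simp only [kpair, kcol, Quantale.mul_iSup, Quantale.star_iSup, InvQuantale.qstar_mul,
    InvQuantale.qstar_star, hk, InvQuantale.qmul_assoc]
  rw [iSup₂_comm]

theorem kpair_congr {I : Type u} {k : I → I → A} (hk : ∀ i j, star (k i j) = k j i)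
    {S S' : Set (I × A)} (T : Set (I × A)) (h : kcol k S = kcol k S') :
    kpair S (kcol k T) = kpair S' (kcol k T) := by
  rw [← kpair_symm hk, h, kpair_symm hk]

theorem kpair_rep {I : Type u} {k : I → I → A} (hk : ∀ i j, star (k i j) = k j i)
    (f g : KCar k) (S : Set (I × A)) (h : f.1 = kcol k S) :
    kpair (krep f) g.1 = kpair S g.1 := by
  rw [krep_spec g]
  exact kpair_congr hk _ ((krep_spec f).symm.trans h)

theorem kpair_star {I : Type u} {k : I → I → A} (hk : ∀ i j, star (k i j) = k j i)
    (f g : KCar k) : star (kpair (krep f) g.1) = kpair (krep g) f.1 := by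
  conv_lhs => rw [krep_spec g]
  conv_rhs => rw [krep_spec f]
  exact kpair_symm hk _ _

theorem kpair_iSup {I : Type u} {ι : Sort w} (S : Set (I × A)) (g : ι → I → A) :
    kpair S (⨆ i, g i) = ⨆ i, kpair S (g i) := by
  simp only [kpair, iSup_apply, Quantale.mul_iSup]
  apply le_antisymm
  · exact iSup₂_le fun x hx => iSup_le fun i => le_iSup_of_le i (le_iSup₂_of_le x hx le_rfl)
  · exact iSup_le fun i => iSup₂_le fun x hx => le_iSup₂_of_le x hx (le_iSup_of_le i le_rfl)

noncomputable def kact {I : Type u} {k : I → I → A} (f : KCar k) (a : A) : KCar k :=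
  ⟨fun i => f.1 i * a, ⟨(fun x => (x.1, x.2 * a)) '' krep f, by
    funext j
    rw [krep_spec f]
    simp only [kcol, iSup_image, Quantale.iSup_mul, InvQuantale.qmul_assoc]⟩⟩

theorem kact_val {I : Type u} {k : I → I → A} (f : KCar k) (a : A) (i : I) :
    (kact f a).val i = f.1 i * a := rfl

@[reducible]
noncomputable def kQMod {I : Type u} (k : I → I → A) : QMod A (KCar k) where
  act := kact
  act_mul m a b := KCar.ext <| funext fun i => (InvQuantale.qmul_assoc _ _ _).symm
  sSup_act S a := KCar.ext <| funext fun i => by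
    rw [kact_val]
    simp only [kLat_sSup, kLat_iSup, iSup_apply, Quantale.iSup_mul, kact_val]
  act_sSup m S := KCar.ext <| funext fun i => by
    rw [kact_val]
    simp only [kact_val, kLat_iSup, iSup_apply, InvQuantale.mul_sSup]

@[reducible]
noncomputable def kHilb {I : Type u} (k : I → I → A) (hk : ∀ i j, star (k i j) = k j i)
    (hsep : Separated A A) : QHilb A (KCar k) where
  toQMod := kQMod k
  ip f g := kpair (krep f) g.1
  ip_mul f g a := by
    show kpair (krep f) g.1 * a = kpair (krep f) (fun i => g.1 i * a)
    simp only [kpair, Quantale.iSup_mul, InvQuantale.qmul_assoc]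
  star_ip f g := kpair_star hk f g
  ip_sSup f T := by
    simp only [kLat_sSup, kpair_iSup]
  sSup_ip T g := by
    have h1 := fun f => (kpair_star hk g f).symm
    rw [h1]
    simp only [kLat_sSup, kpair_iSup, Quantale.star_iSup, ← h1]
  ip_sep m n h := by
    apply KCar.ext
    funext i
    have h2 : ∀ c : A, star c * m.1 i = star c * n.1 i := by
      intro c
      have h3 := h ⟨kcol k {(i, c)}, ⟨_, rfl⟩⟩
      rw [kpair_rep hk _ _ {(i, c)} rfl, kpair_rep hk _ _ {(i, c)} rfl] at h3
      simpa [kpair] using h3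
    have h3 : star (m.1 i) = star (n.1 i) := by
      apply hsep
      intro c
      show star (m.1 i) * c = star (n.1 i) * c
      have := congrArg star (h2 c)
      simpa only [InvQuantale.qstar_mul, InvQuantale.qstar_star] using this
    simpa only [InvQuantale.qstar_star] using congrArg star h3

/-- The basic columns. -/
def kgen {I : Type u} (k : I → I → A) (i : I) (a : A) : KCar k :=
  ⟨kcol k {(i, a)}, ⟨_, rfl⟩⟩

theorem kgen_val {I : Type u} (k : I → I → A) (i : I) (a : A) (j : I) :
    (kgen k i a).val j = k j i * a := by
  simp [kgen, kcol]

theorem kgen_gen {I : Type u} (k : I → I → A) :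
    Gen (fun x : I × A => kgen k x.1 x.2) := by
  intro f
  refine ⟨krep f, KCar.ext (funext fun j => ?_)⟩
  simp only [kLat_iSup, iSup_apply, kgen_val]
  rw [krep_spec f]
  rfl

theorem mreg_gen (hA : InvQuantale.MReg A) : Gen (fun y : A × A => y.1 * y.2) := by
  refine gen_of_sSup fun m => ?_
  have h : m = sSup {x : A | (∃ p a : A, x = p * a) ∧ x ≤ m} := hA.1 m
  simpa [Prod.exists] using h

theorem exists_kernel (hA : InvQuantale.MReg A) {I : Type u} (k : I → I → A)
    (hk : ∀ i j, star (k i j) = k j i) :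
    ∃ (N : HObj A) (φ : I → A → N.carrier),
      Gen (fun x : I × A => φ x.1 x.2) ∧
      (∀ i a j b, qip A (φ i a) (φ j b) = star a * k i j * b) ∧
      (∀ i a b, qact (φ i a) b = φ i (a * b)) := by
  let _ := kHilb k hk hA.2
  have hact : ∀ (i : I) (a b : A), qact (A := A) (kgen k i a) b = kgen k i (a * b) := by
    intro i a b
    apply KCar.ext
    funext j
    show (kgen k i a).val j * b = _
    simp only [kgen_val, InvQuantale.qmul_assoc]
  refine ⟨{ carrier := KCar k, ess := ?_, sep := ?_ }, kgen k, kgen_gen k, ?_, hact⟩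
  · intro f
    refine le_antisymm ?_ (sSup_le fun x hx => hx.2)
    obtain ⟨S, hS⟩ := kgen_gen k f
    conv_lhs => rw [hS]
    refine iSup₂_le fun x hx => ?_
    have hle : kgen k x.1 x.2 ≤ f := by rw [hS]; exact le_iSup₂_of_le x hx le_rfl
    obtain ⟨T, hT⟩ := mreg_gen hA x.2
    have : kgen k x.1 x.2 = ⨆ y ∈ T, kgen k x.1 (y.1 * y.2) := by
      apply KCar.ext
      funext j
      simp only [kLat_iSup, iSup_apply, kgen_val]
      conv_lhs => rw [hT]
      simp only [Quantale.mul_iSup]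
    show kgen k x.1 x.2 ≤ _
    rw [this] at hle ⊢
    refine iSup₂_le fun y hy => le_sSup ⟨⟨kgen k x.1 y.1, y.2, (hact _ _ _).symm⟩, ?_⟩
    exact le_trans (le_iSup₂_of_le y hy le_rfl) hle
  · intro m n h
    apply KCar.ext
    funext i
    exact hA.2 _ _ fun c => congrFun (congrArg KCar.val (h c)) i
  · intro i a j b
    show kpair _ _ = _
    rw [kpair_rep hk _ _ {(i, a)} rfl]
    simp [kpair, kgen_val, InvQuantale.qmul_assoc]

end MKernel

section MTensor
variable {A B : Type u} [InvQuantale A] [InvQuantale B]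

theorem tensor_kernel (hB : InvQuantale.MReg B) (X : BimodObj A B) (M : HObj A) :
    ∃ (N : HObj B) (φ : M.carrier × X.carrier → B → N.carrier),
      Gen (fun x : (M.carrier × X.carrier) × B => φ x.1 x.2) ∧
      (∀ i a j b, qip B (φ i a) (φ j b)
        = star a * qip B i.2 (X.lact (qip A i.1 j.1) j.2) * b) ∧
      (∀ i a b, qact (φ i a) b = φ i (a * b)) := by
  apply exists_kernel hB (fun i j : M.carrier × X.carrier =>
    qip B i.2 (X.lact (qip A i.1 j.1) j.2))
  intro i j
  rw [qstar_ip]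
  rw [show qip B (X.lact (qip A i.1 j.1) j.2) i.2 = _ from X.bimod.ip_lact _ _ _, qstar_ip]

noncomputable def tObj (hB : InvQuantale.MReg B) (X : BimodObj A B) (M : HObj A) : HObj B :=
  Classical.choose (tensor_kernel hB X M)

noncomputable def tgen (hB : InvQuantale.MReg B) (X : BimodObj A B) {M : HObj A}
    (m : M.carrier) (x : X.carrier) (b : B) : (tObj hB X M).carrier :=
  Classical.choose (Classical.choose_spec (tensor_kernel hB X M)) (m, x) b

variable (hB : InvQuantale.MReg B) (X : BimodObj A B)

theorem tgen_gen (M : HObj A) : Gen (fun x : (M.carrier × X.carrier) × B =>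
    tgen hB X x.1.1 x.1.2 x.2) :=
  (Classical.choose_spec (Classical.choose_spec (tensor_kernel hB X M))).1

theorem tgen_ip {M : HObj A} (m n : M.carrier) (x y : X.carrier) (b c : B) :
    qip B (tgen hB X m x b) (tgen hB X n y c)
      = star b * qip B x (X.lact (qip A m n) y) * c :=
  (Classical.choose_spec (Classical.choose_spec (tensor_kernel hB X M))).2.1 (m, x) b (n, y) c

theorem lact_iSup' {ι : Sort w} (a : ι → A) (x : X.carrier) :
    X.lact (⨆ i, a i) x = ⨆ i, X.lact (a i) x := by
  rw [iSup, X.bimod.sSup_lact, iSup_range]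

theorem lact_iSup {ι : Sort w} (a : A) (x : ι → X.carrier) :
    X.lact a (⨆ i, x i) = ⨆ i, X.lact a (x i) := by
  rw [iSup, X.bimod.lact_sSup, iSup_range]

theorem tgen_iSup {M : HObj A} {ι : Sort w} (m : ι → M.carrier) (x : X.carrier) (b : B) :
    tgen hB X (⨆ i, m i) x b = ⨆ i, tgen hB X (m i) x b := by
  apply (tgen_gen hB X M).ip_ext (A := B)
  intro j
  simp only [qip_iSup_right, tgen_ip, lact_iSup', Quantale.iSup_mul, Quantale.mul_iSup]

theorem tmap_exists {M N : HObj A} (f : M ⟶ N) :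
    ∃ g : tObj hB X M ⟶ tObj hB X N,
      (∀ i : (M.carrier × X.carrier) × B, g.1 (tgen hB X i.1.1 i.1.2 i.2)
        = tgen hB X (f.1 i.1.1) i.1.2 i.2) ∧
      (∀ i : (N.carrier × X.carrier) × B, (hStar g).1 (tgen hB X i.1.1 i.1.2 i.2)
        = tgen hB X ((hStar f).1 i.1.1) i.1.2 i.2) := by
  apply homOfGens (tgen_gen hB X M) (tgen_gen hB X N)
    (fun i => tgen hB X (f.1 i.1.1) i.1.2 i.2)
    (fun i => tgen hB X ((hStar f).1 i.1.1) i.1.2 i.2)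
  intro i j
  rw [tgen_ip, tgen_ip, hStar_ip]

noncomputable def tmap {M N : HObj A} (f : M ⟶ N) : tObj hB X M ⟶ tObj hB X N :=
  Classical.choose (tmap_exists hB X f)

theorem tmap_app {M N : HObj A} (f : M ⟶ N) (m : M.carrier) (x : X.carrier) (b : B) :
    (tmap hB X f).1 (tgen hB X m x b) = tgen hB X (f.1 m) x b :=
  (Classical.choose_spec (tmap_exists hB X f)).1 ((m, x), b)

theorem tmap_star_app {M N : HObj A} (f : M ⟶ N) (m : N.carrier) (x : X.carrier) (b : B) :
    (hStar (tmap hB X f)).1 (tgen hB X m x b) = tgen hB X ((hStar f).1 m) x b :=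
  (Classical.choose_spec (tmap_exists hB X f)).2 ((m, x), b)

noncomputable def tFun : StarFunctor A B where
  toFunctor :=
    { obj := tObj hB X
      map := fun f => tmap hB X f
      map_id := fun M => (tgen_gen hB X M).hom_ext fun i => by
        rw [tmap_app, id_app, id_app]
      map_comp := fun f g => (tgen_gen hB X _).hom_ext fun i => by
        rw [tmap_app, comp_app, comp_app, tmap_app, tmap_app] }
  map_star f := (tgen_gen hB X _).hom_ext fun i => by
    show (tmap hB X _).1 _ = (hStar (tmap hB X _)).1 _
    rw [tmap_app, tmap_star_app]
  map_hSup S := (tgen_gen hB X _).hom_ext fun i => by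
    show (tmap hB X _).1 _ = _
    rw [tmap_app, hSup_app, hSup_app, iSup_image]
    simp only [tgen_iSup]
    refine iSup_congr fun f => iSup_congr fun _ => ?_
    show _ = (tmap hB X f).1 _
    rw [tmap_app]

theorem counit_exists (hA : InvQuantale.MReg A) (Y : BimodObj B A)
    (τ : X.carrier → Y.carrier → A)
    (h1 : ∀ x y x' y', star (τ x y) * τ x' y' = qip A y (Y.lact (qip B x x') y'))
    (h2 : ∀ a x y, τ (X.lact a x) y = a * τ x y)
    (h3 : Gen (fun i : X.carrier × Y.carrier => τ i.1 i.2))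
    (hY : LEssentialAct Y.lact) :
    ∃ η : (tFun hB X).toFunctor ⋙ (tFun hA Y).toFunctor ⟶ 𝟭 (HObj A),
      ∀ M, IsUnitaryHom (η.app M) := by
  have sepA : ∀ {c d : A}, (∀ x y, star (τ x y) * c = star (τ x y) * d) → c = d := by
    intro c d h
    have := (selfQHilb hA.2).ip_sep c d
    apply this
    intro e
    obtain ⟨S, rfl⟩ := h3 e
    show star _ * _ = star _ * _
    simp only [Quantale.star_iSup, Quantale.iSup_mul, h]
  have hbal : ∀ x b y, τ (qact x b) y = τ x (Y.lact b y) := by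
    intro x b y
    apply sepA
    intro x' y'
    rw [h1, h1, qip_act_right, Y.bimod.lact_mul]
  have hjoin : ∀ {ι : Type u} (x : X.carrier) (y : ι → Y.carrier),
      τ x (⨆ i, y i) = ⨆ i, τ x (y i) := by
    intro ι x y
    apply sepA
    intro x' y'
    simp only [Quantale.mul_iSup, h1, lact_iSup, qip_iSup_right]
  have hjoin2 : ∀ {ι : Type u} (S : Set ι) (x : X.carrier) (y : ι → Y.carrier),
      τ x (⨆ i ∈ S, y i) = ⨆ i ∈ S, τ x (y i) := by
    intro ι S x y
    rw [iSup_subtype', hjoin, iSup_subtype']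
  have hYg : Gen (fun i : B × Y.carrier => Y.lact i.1 i.2) :=
    gen_of_sSup fun m => by simpa [Prod.exists] using hY m
  -- generation of `A`
  have g1 : Gen (fun i : X.carrier × B × Y.carrier => τ (qact i.1 i.2.1) i.2.2) := by
    refine h3.trans ?_
    rintro ⟨x, y⟩
    obtain ⟨S, hS⟩ := hYg y
    refine ⟨(fun s => (x, s)) '' S, ?_⟩
    rw [iSup_image]
    show τ x y = _
    conv_lhs => rw [hS]
    rw [hjoin2]
    simp only [hbal]
  have g2 : Gen (fun i : (X.carrier × B × Y.carrier) × A =>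
      τ (qact i.1.1 i.1.2.1) i.1.2.2 * i.2) := by
    refine (mreg_gen hA).trans ?_
    rintro ⟨c, a⟩
    obtain ⟨S, hS⟩ := g1 c
    refine ⟨(fun s => (s, a)) '' S, ?_⟩
    rw [iSup_image]
    show c * a = _
    conv_lhs => rw [hS]
    simp only [Quantale.iSup_mul]
  have gq : ∀ M : HObj A, Gen (fun i : M.carrier × (X.carrier × B × Y.carrier) × A =>
      qact i.1 (τ (qact i.2.1.1 i.2.1.2.1) i.2.1.2.2 * i.2.2)) := by
    intro M
    refine M.gen.trans ?_
    rintro ⟨m, a⟩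
    obtain ⟨S, hS⟩ := g2 a
    refine ⟨(fun s => (m, s)) '' S, ?_⟩
    rw [iSup_image]
    show qact m a = _
    conv_lhs => rw [hS]
    simp only [qact_iSup_right]
  have gp : ∀ M : HObj A, Gen (fun i : M.carrier × (X.carrier × B × Y.carrier) × A =>
      tgen hA Y (tgen hB X i.1 i.2.1.1 i.2.1.2.1) i.2.1.2.2 i.2.2) := by
    intro M
    refine (tgen_gen hA Y (tObj hB X M)).trans ?_
    rintro ⟨⟨n, y⟩, a⟩
    obtain ⟨S, hS⟩ := tgen_gen hB X M n
    refine ⟨(fun s : (M.carrier × X.carrier) × B => (s.1.1, (s.1.2, s.2, y), a)) '' S, ?_⟩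
    rw [iSup_image]
    show tgen hA Y n y a = _
    conv_lhs => rw [hS]
    simp only [tgen_iSup]
  have key : ∀ M : HObj A, ∃ f : tObj hA Y (tObj hB X M) ⟶ M,
      (∀ i : M.carrier × (X.carrier × B × Y.carrier) × A,
        f.1 (tgen hA Y (tgen hB X i.1 i.2.1.1 i.2.1.2.1) i.2.1.2.2 i.2.2)
          = qact i.1 (τ (qact i.2.1.1 i.2.1.2.1) i.2.1.2.2 * i.2.2)) ∧ IsUnitaryHom f := by
    intro M
    refine unitaryOfGens (gp M) (gq M) ?_
    rintro ⟨m, ⟨x, b, y⟩, a⟩ ⟨m', ⟨x', b', y'⟩, a'⟩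
    simp only
    rw [tgen_ip, tgen_ip, qip_act_right, qip_act_left, InvQuantale.qstar_mul]
    have e : star b * qip B x (X.lact (qip A m m') x') * b'
        = qip B (qact x b) (X.lact (qip A m m') (qact x' b')) := by
      rw [X.bimod.lact_act, qip_act_right, qip_act_left]
    rw [e, ← h1, h2]
    simp only [InvQuantale.qmul_assoc]
  choose f hf1 hf2 using key
  refine ⟨{ app := f, naturality := ?_ }, hf2⟩
  intro M N g
  refine (gp M).hom_ext ?_
  intro i
  show (f N).1 ((tmap hA Y (tmap hB X g)).1 _) = g.1 ((f M).1 _)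
  rw [hf1, tmap_app, tmap_app, hom_act]
  exact hf1 N (g.1 i.1, i.2)

end MTensor

section MBack
variable {A B : Type u} [InvQuantale A] [InvQuantale B]

theorem counit_of_data (hA : InvQuantale.MReg A) (hB : InvQuantale.MReg B)
    (X : BimodObj A B) (Y : BimodObj B A) (hY : LEssentialAct Y.lact)
    (h : ∃ (P : HilbMod A) (t : X.carrier → Y.carrier → P.carrier)
           (lP : A → P.carrier → P.carrier) (Φ : P.carrier → A),
           IsInteriorTensor B A Y.lact t ∧
           (∀ (a : A) (x : X.carrier) (y : Y.carrier), lP a (t x y) = t (X.lact a x) y) ∧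
           Function.Bijective Φ ∧
           (∀ S : Set P.carrier, Φ (sSup S) = ⨆ p ∈ S, Φ p) ∧
           (∀ (a : A) (p : P.carrier), Φ (lP a p) = a * Φ p) ∧
           (∀ (p : P.carrier) (a : A), Φ (qact p a) = Φ p * a) ∧
           (∀ p q : P.carrier, qip A (Φ p) (Φ q) = qip A p q)) :
    ∃ η : (tFun hB X).toFunctor ⋙ (tFun hA Y).toFunctor ⟶ 𝟭 (HObj A),
      ∀ M, IsUnitaryHom (η.app M) := by
  obtain ⟨P, t, lP, Φ, ht, hl, hbij, hsup, hl2, -, hip⟩ := h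
  apply counit_exists hB X hA Y (fun x y => Φ (t x y)) _ _ _ hY
  · intro x y x' y'
    rw [← ht.ip_t]
    exact hip _ _
  · intro a x y
    rw [← hl, hl2]
  · intro a
    obtain ⟨p, rfl⟩ := hbij.2 a
    have hg : Gen (fun i : X.carrier × Y.carrier => t i.1 i.2) :=
      gen_of_sSup fun m => by simpa [Prod.exists] using ht.gen m
    obtain ⟨S, hS⟩ := hg p
    refine ⟨S, ?_⟩
    conv_lhs => rw [hS]
    rw [← sSup_image, hsup, iSup_image]

end MBack

section MConstr
variable {A : Type u} [InvQuantale A]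

theorem hzero_app {M N : HObj A} (m : M.carrier) : (hSup (∅ : Set (M ⟶ N))).1 m = ⊥ := by
  rw [hSup_app]; simp

theorem hzero_star {M N : HObj A} :
    hStar (hSup (∅ : Set (M ⟶ N))) = hSup (∅ : Set (N ⟶ M)) :=
  hStar_eq fun m n => by rw [hzero_app, hzero_app, qip_bot_left, qip_bot_right]

theorem self_sep (hA : InvQuantale.MReg A) {c d : A} (h : ∀ b : A, star b * c = star b * d) :
    c = d :=
  (selfQHilb hA.2).ip_sep c d fun b => h b

/-- Application of a morphism out of `A`. -/
def sapp {hA : InvQuantale.MReg A} {N : HObj A} (g : selfObj A hA ⟶ N) (b : A) : N.carrier :=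
  g.1 b

/-- Application of the adjoint of a morphism out of `A`. -/
noncomputable def sstar {hA : InvQuantale.MReg A} {N : HObj A} (g : selfObj A hA ⟶ N)
    (x : N.carrier) : A := (hStar g).1 x

section
variable {hA : InvQuantale.MReg A}

theorem sapp_ext {N : HObj A} {g h : selfObj A hA ⟶ N} (e : ∀ b, sapp g b = sapp h b) :
    g = h := hom_ext' e

theorem sapp_comp {N K : HObj A} (g : selfObj A hA ⟶ N) (r : N ⟶ K) (b : A) :
    sapp (g ≫ r) b = r.1 (sapp g b) := rfl

theorem sstar_comp {N K : HObj A} (g : selfObj A hA ⟶ N) (r : N ⟶ K) (x : K.carrier) :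
    sstar (g ≫ r) x = sstar g ((hStar r).1 x) := by
  rw [sstar, hStar_comp]; rfl

theorem sapp_ip {N : HObj A} (g : selfObj A hA ⟶ N) (b : A) (x : N.carrier) :
    qip A (sapp g b) x = star b * sstar g x := hStar_adj g b x

theorem sstar_iSup {N : HObj A} (g : selfObj A hA ⟶ N) {ι : Sort w} (x : ι → N.carrier) :
    sstar g (⨆ i, x i) = ⨆ i, sstar g (x i) := hom_iSup (hStar g) x

theorem sstar_eq {N : HObj A} (g : selfObj A hA ⟶ N)
    (x : N.carrier) (c : A) (h : ∀ b : A, qip A (sapp g b) x = star b * c) :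
    sstar g x = c :=
  self_sep hA fun b => by rw [← h, sapp_ip]

theorem sapp_zero {N : HObj A} (b : A) : sapp (hSup (∅ : Set (selfObj A hA ⟶ N))) b = ⊥ :=
  hzero_app _

theorem selfHom {J : Type v} {N : HObj A} {q : J → N.carrier} (hq : Gen q)
    (α : A → N.carrier) (β : J → A) (h : ∀ b j, qip A (α b) (q j) = star b * β j) :
    ∃ g : selfObj A hA ⟶ N, (∀ b, sapp g b = α b) ∧ ∀ j, sstar g (q j) = β j :=
  homOfGens (M := selfObj A hA) (N := N) Gen.self hq α β h

end

/-- The morphism `b ↦ n ⋄ b`. -/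
def thHom (hA : InvQuantale.MReg A) {N : HObj A} (n : N.carrier) : selfObj A hA ⟶ N :=
  ⟨fun b : A => qact n b, ⟨fun x => (qip A n x : A), fun (b : A) x => by
    show qip A (qact n b) x = star b * qip A n x
    rw [qip_act_left]⟩⟩

theorem thHom_app (hA : InvQuantale.MReg A) {N : HObj A} (n : N.carrier) (b : A) :
    sapp (thHom hA n) b = qact n b := rfl

theorem thHom_star (hA : InvQuantale.MReg A) {N : HObj A} (n x : N.carrier) :
    sstar (thHom hA n) x = qip A n x :=
  sstar_eq _ _ _ fun b => by rw [thHom_app, qip_act_left]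

theorem thHom_comp (hA : InvQuantale.MReg A) {N K : HObj A} (n : N.carrier) (f : N ⟶ K) :
    thHom hA n ≫ f = thHom hA (f.1 n) :=
  sapp_ext fun b => by rw [sapp_comp, thHom_app, thHom_app, hom_act]

inductive SIdx (N Y P : Type u) : Type u
  | s (n : N) (y : Y)
  | p (p : P)

theorem S_constr (hA : InvQuantale.MReg A) (P Y : HObj A) (N : Type u) (ψ : N → (Y ⟶ P)) :
    ∃ (S : HObj A) (r : S ⟶ P) (ψt : N → (Y ⟶ S)),
      (∀ n, ψt n ≫ r = ψ n) ∧
      (∀ s, ∃ T : Set (N × Y.carrier), r.1 s = ⨆ i ∈ T, (ψ i.1).1 i.2) := by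
  obtain ⟨S, φ, hg, hip, hact⟩ := exists_kernel hA
    (I := SIdx N Y.carrier P.carrier)
    (fun i j => match i, j with
      | .s n y, .p p => qip A ((ψ n).1 y) p
      | .p p, .s n y => qip A p ((ψ n).1 y)
      | _, _ => ⊥) (by
    rintro (_ | _) (_ | _) <;> simp [qstar_bot, qstar_ip])
  obtain ⟨r, hr1, hr2⟩ := homOfGens (M := S) (N := P) hg P.gen
    (fun i => match i.1 with
      | .s n y => qact ((ψ n).1 y) i.2
      | .p _ => ⊥)
    (fun j => φ (.p j.1) j.2) (by
    rintro ⟨(_ | _), a⟩ ⟨p, b⟩ <;>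
      simp [hip, qip_act_left, qip_act_right, qip_bot_left, qmul_bot, qbot_mul,
        InvQuantale.qmul_assoc])
  have hψ := fun n => homOfGens (M := Y) (N := S) Y.gen hg
    (fun i => φ (.s n i.1) i.2)
    (fun j => match j.1 with
      | .s _ _ => ⊥
      | .p p => qact ((hStar (ψ n)).1 p) j.2) (by
    rintro ⟨y, a⟩ ⟨(_ | _), b⟩ <;>
      simp [hip, qip_act_left, qip_act_right, qip_bot_right, qmul_bot, qbot_mul,
        InvQuantale.qmul_assoc, hStar_ip])
  choose ψt ht1 ht2 using hψ
  refine ⟨S, r, ψt, ?_, ?_⟩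
  · intro n
    refine Y.gen.hom_ext fun i => ?_
    rw [comp_app, ht1, hr1 (.s n i.1, i.2), hom_act]
  · intro s
    obtain ⟨W, rfl⟩ := hg s
    refine ⟨{i | ∃ n y a, (SIdx.s n y, a) ∈ W ∧ i = (n, qact y a)}, ?_⟩
    simp only [hom_iSup, hr1]
    apply le_antisymm
    · refine iSup₂_le ?_
      rintro ⟨(⟨n, y⟩ | p), a⟩ hW
      · exact le_iSup₂_of_le (n, qact y a) ⟨n, y, a, hW, rfl⟩ (hom_act _ _ _).ge
      · exact bot_le
    · refine iSup₂_le ?_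
      rintro _ ⟨n, y, a, hW, rfl⟩
      exact le_iSup₂_of_le _ hW (hom_act _ _ _).le

inductive DIdx (N Z : Type u) : Type u
  | r1 (n : N)
  | r2 (n : N)
  | x1 (n : N)
  | x2 (n : N)
  | c (z : Z)

theorem D_constr (hA : InvQuantale.MReg A) (N Z : HObj A)
    (g : N.carrier → (selfObj A hA ⟶ Z)) :
    ∃ (D : HObj A) (v1 v2 : D ⟶ N) (m : D ⟶ Z) (t1 t2 : N.carrier → (selfObj A hA ⟶ D)),
      (∀ r : Z ⟶ N, (∀ n, g n ≫ r = thHom hA n) → m ≫ r = hSup {v1, v2}) ∧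
      (∀ n, t1 n ≫ v1 = thHom hA n) ∧ (∀ n, t1 n ≫ v2 = hSup ∅) ∧
      (∀ n, t2 n ≫ v1 = hSup ∅) ∧ (∀ n, t2 n ≫ v2 = thHom hA n) ∧
      (∀ d, ∃ (x : N.carrier) (e : N.carrier → A),
        (∀ n, sstar (t1 n) d = qip A n x ⊔ e n) ∧ ∀ n, e n ≤ sstar (t2 n) d) := by
  obtain ⟨D, φ, hg, hip, hact⟩ := exists_kernel hA
    (I := DIdx N.carrier Z.carrier)
    (fun i j => match i, j with
      | .r1 n, .x1 x => qip A n x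
      | .x1 x, .r1 n => qip A x n
      | .r2 n, .x2 x => qip A n x
      | .x2 x, .r2 n => qip A x n
      | .r1 n, .c w => sstar (g n) w
      | .c w, .r1 n => star (sstar (g n) w)
      | .r2 n, .c w => sstar (g n) w
      | .c w, .r2 n => star (sstar (g n) w)
      | _, _ => ⊥) (by
    rintro (_ | _ | _ | _ | _) (_ | _ | _ | _ | _) <;>
      simp [qstar_bot, qstar_ip, InvQuantale.qstar_star])
  obtain ⟨v1, hv1, -⟩ := homOfGens (M := D) (N := N) hg N.gen
    (fun i => match i.1 with
      | .r1 n => qact n i.2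
      | _ => ⊥)
    (fun j => φ (.x1 j.1) j.2) (by
    rintro ⟨(_ | _ | _ | _ | _), a⟩ ⟨p, b⟩ <;>
      simp [hip, qip_act_left, qip_act_right, qip_bot_left, qmul_bot, qbot_mul,
        InvQuantale.qmul_assoc])
  obtain ⟨v2, hv2, -⟩ := homOfGens (M := D) (N := N) hg N.gen
    (fun i => match i.1 with
      | .r2 n => qact n i.2
      | _ => ⊥)
    (fun j => φ (.x2 j.1) j.2) (by
    rintro ⟨(_ | _ | _ | _ | _), a⟩ ⟨p, b⟩ <;>
      simp [hip, qip_act_left, qip_act_right, qip_bot_left, qmul_bot, qbot_mul,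
        InvQuantale.qmul_assoc])
  obtain ⟨m, hm, -⟩ := homOfGens (M := D) (N := Z) hg Z.gen
    (fun i => match i.1 with
      | .r1 n => sapp (g n) i.2
      | .r2 n => sapp (g n) i.2
      | _ => ⊥)
    (fun j => φ (.c j.1) j.2) (by
    rintro ⟨(_ | _ | _ | _ | _), a⟩ ⟨p, b⟩ <;>
      simp [hip, qip_act_right, qip_bot_left, qmul_bot, qbot_mul, sapp_ip])
  have ht1 := fun n => selfHom (hA := hA) (N := D) hg
    (fun b : A => φ (.r1 n) b)
    (fun j => match j.1 with
      | .x1 x => qip A n x * j.2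
      | .c w => sstar (g n) w * j.2
      | _ => ⊥) (by
    rintro b ⟨(_ | _ | _ | _ | _), c⟩ <;>
      simp [hip, qmul_bot, qbot_mul, InvQuantale.qmul_assoc])
  have ht2 := fun n => selfHom (hA := hA) (N := D) hg
    (fun b : A => φ (.r2 n) b)
    (fun j => match j.1 with
      | .x2 x => qip A n x * j.2
      | .c w => sstar (g n) w * j.2
      | _ => ⊥) (by
    rintro b ⟨(_ | _ | _ | _ | _), c⟩ <;>
      simp [hip, qmul_bot, qbot_mul, InvQuantale.qmul_assoc])
  choose t1 ht1 hs1 using ht1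
  choose t2 ht2 hs2 using ht2
  refine ⟨D, v1, v2, m, t1, t2, ?_, ?_, ?_, ?_, ?_, ?_⟩
  · intro r hr
    have hr' : ∀ n (b : A), r.1 (sapp (g n) b) = qact n b := fun n b => by
      rw [← sapp_comp, hr, thHom_app]
    refine hg.hom_ext ?_
    rintro ⟨i, b⟩
    rw [comp_app, hSup_app, iSup_pair, hm, hv1, hv2]
    cases i <;> simp [hr', hom_bot]
  · exact fun n => sapp_ext fun b => by
      rw [sapp_comp, ht1, hv1 (.r1 n, b), thHom_app]
  · exact fun n => sapp_ext fun b => by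
      rw [sapp_comp, ht1, hv2 (.r1 n, b), sapp_zero]
  · exact fun n => sapp_ext fun b => by
      rw [sapp_comp, ht2, hv1 (.r2 n, b), sapp_zero]
  · exact fun n => sapp_ext fun b => by
      rw [sapp_comp, ht2, hv2 (.r2 n, b), thHom_app]
  · intro d
    obtain ⟨W, rfl⟩ := hg d
    refine ⟨⨆ j ∈ W, (match j.1 with
        | .x1 x => qact x j.2
        | _ => ⊥), fun n => ⨆ j ∈ W, (match j.1 with
        | .c w => sstar (g n) w * j.2
        | _ => ⊥), ?_, ?_⟩
    · intro n
      simp only [sstar_iSup, hs1, qip_iSup_right]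
      rw [← iSup_sup_eq]
      refine iSup_congr fun j => ?_
      rw [← iSup_sup_eq]
      refine iSup_congr fun _ => ?_
      obtain ⟨(_ | _ | _ | _ | _), c⟩ := j <;> simp [qip_bot_right, qip_act_right]
    · intro n
      simp only [sstar_iSup, hs2]
      refine iSup₂_mono fun j hj => ?_
      obtain ⟨(_ | _ | _ | _ | _), c⟩ := j <;> simp

inductive UIdx (N Y P D : Type u) : Type u
  | a (n : N) (y : Y)
  | b (p : P)
  | c (d : D)
  | q1 (p : P)
  | q2 (p : P)

theorem U_constr (hA : InvQuantale.MReg A) (P Y D : HObj A) (N : Type u) (ψ : N → (Y ⟶ P))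
    (v1 v2 : D ⟶ P) :
    ∃ (U : HObj A) (r1 r2 : U ⟶ P) (i2 : P ⟶ U) (ψh : N → (Y ⟶ U)) (τ : D ⟶ U),
      (∀ n, ψh n ≫ r1 = ψ n) ∧ (∀ n, ψh n ≫ r2 = hSup ∅) ∧
      (i2 ≫ r1 = hSup ∅) ∧ (i2 ≫ r2 = 𝟙 P) ∧
      (∀ n (f : Y ⟶ D), f ≫ v1 = ψ n → f ≫ v2 = hSup ∅ → f ≫ τ = ψh n) ∧
      (∀ n (f : Y ⟶ D), f ≫ v1 = hSup ∅ → f ≫ v2 = ψ n → f ≫ τ = ψ n ≫ i2) ∧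
      (∀ x, ∃ (T : Set (N × Y.carrier)) (E : Set D.carrier),
        r1.1 x = (⨆ i ∈ T, (ψ i.1).1 i.2) ⊔ ⨆ d ∈ E, v1.1 d ∧
        ∀ d ∈ E, v2.1 d ≤ r2.1 x) := by
  obtain ⟨U, φ, hg, hip, hact⟩ := exists_kernel hA
    (I := UIdx N Y.carrier P.carrier D.carrier)
    (fun i j => match i, j with
      | .a n y, .q1 p => qip A ((ψ n).1 y) p
      | .q1 p, .a n y => qip A p ((ψ n).1 y)
      | .b p', .q2 p => qip A p' p
      | .q2 p, .b p' => qip A p p'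
      | .c d, .q1 p => qip A (v1.1 d) p
      | .q1 p, .c d => qip A p (v1.1 d)
      | .c d, .q2 p => qip A (v2.1 d) p
      | .q2 p, .c d => qip A p (v2.1 d)
      | _, _ => ⊥) (by
    rintro (_ | _ | _ | _ | _) (_ | _ | _ | _ | _) <;>
      simp [qstar_bot, qstar_ip])
  obtain ⟨r1, hr1, hr1s⟩ := homOfGens (M := U) (N := P) hg P.gen
    (fun i => match i.1 with
      | .a n y => qact ((ψ n).1 y) i.2
      | .c d => qact (v1.1 d) i.2
      | _ => ⊥)
    (fun j => φ (.q1 j.1) j.2) (by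
    rintro ⟨(_ | _ | _ | _ | _), a⟩ ⟨p, b⟩ <;>
      simp [hip, qip_act_left, qip_act_right, qip_bot_left, qmul_bot, qbot_mul,
        InvQuantale.qmul_assoc])
  obtain ⟨r2, hr2, hr2s⟩ := homOfGens (M := U) (N := P) hg P.gen
    (fun i => match i.1 with
      | .b p => qact p i.2
      | .c d => qact (v2.1 d) i.2
      | _ => ⊥)
    (fun j => φ (.q2 j.1) j.2) (by
    rintro ⟨(_ | _ | _ | _ | _), a⟩ ⟨p, b⟩ <;>
      simp [hip, qip_act_left, qip_act_right, qip_bot_left, qmul_bot, qbot_mul,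
        InvQuantale.qmul_assoc])
  obtain ⟨i2, hi2, hi2s⟩ := homOfGens (M := P) (N := U) P.gen hg
    (fun i => φ (.b i.1) i.2)
    (fun j => match j.1 with
      | .q2 p => qact p j.2
      | _ => ⊥) (by
    rintro ⟨y, a⟩ ⟨(_ | _ | _ | _ | _), b⟩ <;>
      simp [hip, qip_act_left, qip_act_right, qip_bot_right, qmul_bot, qbot_mul,
        InvQuantale.qmul_assoc])
  have hψ := fun n => homOfGens (M := Y) (N := U) Y.gen hg
    (fun i => φ (.a n i.1) i.2)
    (fun j => match j.1 with
      | .q1 p => qact ((hStar (ψ n)).1 p) j.2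
      | _ => ⊥) (by
    rintro ⟨y, a⟩ ⟨(_ | _ | _ | _ | _), b⟩ <;>
      simp [hip, qip_act_left, qip_act_right, qip_bot_right, qmul_bot, qbot_mul,
        InvQuantale.qmul_assoc, hStar_ip])
  choose ψh hh1 hh2 using hψ
  obtain ⟨τ, hτ, hτs⟩ := homOfGens (M := D) (N := U) D.gen hg
    (fun i => φ (.c i.1) i.2)
    (fun j => match j.1 with
      | .q1 p => qact ((hStar v1).1 p) j.2
      | .q2 p => qact ((hStar v2).1 p) j.2
      | _ => ⊥) (by
    rintro ⟨y, a⟩ ⟨(_ | _ | _ | _ | _), b⟩ <;>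
      simp [hip, qip_act_left, qip_act_right, qip_bot_right, qmul_bot, qbot_mul,
        InvQuantale.qmul_assoc, hStar_ip])
  have star_inj : ∀ {M K : HObj A} {f g : M ⟶ K}, hStar f = hStar g → f = g := by
    intro M K f g h
    rw [← hStar_hStar f, h, hStar_hStar]
  refine ⟨U, r1, r2, i2, ψh, τ, ?_, ?_, ?_, ?_, ?_, ?_, ?_⟩
  · intro n
    refine Y.gen.hom_ext fun i => ?_
    rw [comp_app, hh1, hr1 (.a n i.1, i.2), hom_act]
  · intro n
    refine Y.gen.hom_ext fun i => ?_
    rw [comp_app, hh1, hr2 (.a n i.1, i.2), hzero_app]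
  · refine P.gen.hom_ext fun i => ?_
    rw [comp_app, hi2, hr1 (.b i.1, i.2), hzero_app]
  · refine P.gen.hom_ext fun i => ?_
    rw [comp_app, hi2, hr2 (.b i.1, i.2), id_app]
  · intro n f h1 h2
    apply star_inj
    refine hg.hom_ext fun j => ?_
    have e1 := congrArg hStar h1
    have e2 := congrArg hStar h2
    rw [hStar_comp] at e1 e2
    rw [hzero_star] at e2
    have e1' : ∀ p, (hStar f).1 ((hStar v1).1 p) = (hStar (ψ n)).1 p := fun p => by
      rw [← comp_app, e1]
    have e2' : ∀ p, (hStar f).1 ((hStar v2).1 p) = ⊥ := fun p => by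
      rw [← comp_app, e2, hzero_app]
    rw [hStar_comp, comp_app, hτs, hh2]
    obtain ⟨(_ | _ | _ | _ | _), b⟩ := j <;> simp [hom_bot, hom_act, e1', e2', qact_bot_left]
  · intro n f h1 h2
    apply star_inj
    refine hg.hom_ext fun j => ?_
    have e1 := congrArg hStar h1
    have e2 := congrArg hStar h2
    rw [hStar_comp] at e1 e2
    rw [hzero_star] at e1
    have e1' : ∀ p, (hStar f).1 ((hStar v2).1 p) = (hStar (ψ n)).1 p := fun p => by
      rw [← comp_app, e2]
    have e2' : ∀ p, (hStar f).1 ((hStar v1).1 p) = ⊥ := fun p => by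
      rw [← comp_app, e1, hzero_app]
    rw [hStar_comp, comp_app, hτs, hStar_comp, comp_app, hi2s]
    obtain ⟨(_ | _ | _ | _ | _), b⟩ := j <;> simp [hom_bot, hom_act, e1', e2', qact_bot_left]
  · intro x
    obtain ⟨W, rfl⟩ := hg x
    refine ⟨{i | ∃ n y a, (UIdx.a n y, a) ∈ W ∧ i = (n, qact y a)},
      {d | ∃ d' a, (UIdx.c d', a) ∈ W ∧ d = qact d' a}, ?_, ?_⟩
    · simp only [hom_iSup, hr1]
      apply le_antisymm
      · refine iSup₂_le ?_
        rintro ⟨(⟨n, y⟩ | p | d | p | p), a⟩ hW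
        · exact le_sup_of_le_left
            (le_iSup₂_of_le (n, qact y a) ⟨n, y, a, hW, rfl⟩ (hom_act _ _ _).ge)
        · exact bot_le
        · exact le_sup_of_le_right
            (le_iSup₂_of_le (qact d a) ⟨d, a, hW, rfl⟩ (hom_act _ _ _).ge)
        · exact bot_le
        · exact bot_le
      · refine sup_le (iSup₂_le ?_) (iSup₂_le ?_)
        · rintro _ ⟨n, y, a, hW, rfl⟩
          exact le_iSup₂_of_le _ hW (hom_act _ _ _).le
        · rintro _ ⟨d, a, hW, rfl⟩
          exact le_iSup₂_of_le _ hW (hom_act _ _ _).le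
    · rintro _ ⟨d, a, hW, rfl⟩
      simp only [hom_iSup, hr2]
      exact le_iSup₂_of_le _ hW (hom_act _ _ _).le

end MConstr

section MMain
variable {A B : Type u} [InvQuantale A] [InvQuantale B]

theorem comp_hSup_pair {M N K : HObj A} (f : M ⟶ N) (g h : N ⟶ K) :
    f ≫ hSup {g, h} = hSup {f ≫ g, f ≫ h} := by
  apply hom_ext'
  intro m
  rw [comp_app, hSup_app, hSup_app, iSup_pair, iSup_pair]
  rfl

theorem comp_hzero {M N K : HObj A} (f : M ⟶ N) :
    f ≫ hSup (∅ : Set (N ⟶ K)) = hSup ∅ := by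
  apply hom_ext'
  intro m
  rw [comp_app, hzero_app, hzero_app]

theorem StarFunctor.map_hzero (F : StarFunctor A B) {M N : HObj A} :
    F.toFunctor.map (hSup (∅ : Set (M ⟶ N))) = hSup ∅ := by
  rw [F.map_hSup, Set.image_empty]

theorem main_gen (hA : InvQuantale.MReg A) (hB : InvQuantale.MReg B) (F : StarFunctor A B)
    (hfaith : ∀ {M N : HObj A} {f g : M ⟶ N}, F.toFunctor.map f = F.toFunctor.map g → f = g)
    (hfull : ∀ {M N : HObj A} (g : F.toFunctor.obj M ⟶ F.toFunctor.obj N),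
      ∃ f : M ⟶ N, F.toFunctor.map f = g)
    (hess : ∀ D : HObj B, ∃ (D' : HObj A) (κ : F.toFunctor.obj D' ⟶ D), IsUnitaryHom κ)
    (Y P : HObj A) (θ : F.toFunctor.obj Y ⟶ selfObj B hB) (hθ : IsUnitaryHom θ)
    (ψ : (F.toFunctor.obj P).carrier → (Y ⟶ P))
    (hψ : ∀ n, F.toFunctor.map (ψ n) = θ ≫ thHom hB n) :
    Gen (fun i : (F.toFunctor.obj P).carrier × Y.carrier => (ψ i.1).1 i.2) := by
  have hθ2 : ∀ {K : HObj B} (f : selfObj B hB ⟶ K), hStar θ ≫ θ ≫ f = f := fun f => by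
    rw [← Category.assoc, hθ.2, Category.id_comp]
  obtain ⟨S, r, ψt, hψt, hS⟩ := S_constr hA P Y _ ψ
  obtain ⟨D, u1, u2, m, t1, t2, hm, h11, h12, h21, h22, hD⟩ :=
    D_constr hB (F.toFunctor.obj P) (F.toFunctor.obj S)
      (fun n => hStar θ ≫ F.toFunctor.map (ψt n))
  have hmr := hm (F.toFunctor.map r) (fun n => by
    rw [Category.assoc, ← F.toFunctor.map_comp, hψt, hψ, hθ2])
  obtain ⟨D', κ, hκ⟩ := hess D
  have hκ2 : ∀ {K : HObj B} (f : D ⟶ K), hStar κ ≫ κ ≫ f = f := fun f => by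
    rw [← Category.assoc, hκ.2, Category.id_comp]
  obtain ⟨v1, hv1⟩ := hfull (κ ≫ u1)
  obtain ⟨v2, hv2⟩ := hfull (κ ≫ u2)
  obtain ⟨w, hw⟩ := hfull (κ ≫ m)
  have hwr : w ≫ r = hSup {v1, v2} := hfaith (by
    rw [F.toFunctor.map_comp, hw, Category.assoc, hmr, F.map_hSup, Set.image_pair,
      comp_hSup_pair, hv1, hv2])
  have hv12 : ∀ d, v1.1 d ⊔ v2.1 d = r.1 (w.1 d) := fun d => by
    rw [← comp_app, hwr, hSup_app, iSup_pair]
  choose f1 hf1 using fun n => hfull (θ ≫ t1 n ≫ hStar κ)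
  choose f2 hf2 using fun n => hfull (θ ≫ t2 n ≫ hStar κ)
  obtain ⟨U, r1, r2, i2, ψh, τ, hr1, hr2, hi1, hi2, hτ1, hτ2, hU⟩ :=
    U_constr hA P Y D' _ ψ v1 v2
  have e1 : ∀ n, f1 n ≫ τ = ψh n := fun n => hτ1 n (f1 n)
    (hfaith (by simp only [F.toFunctor.map_comp, hf1, hv1, Category.assoc, hκ2, h11, hψ]))
    (hfaith (by simp only [F.toFunctor.map_comp, hf1, hv2, Category.assoc, hκ2, h12,
      comp_hzero, F.map_hzero]))
  have e2 : ∀ n, f2 n ≫ τ = ψ n ≫ i2 := fun n => hτ2 n (f2 n)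
    (hfaith (by simp only [F.toFunctor.map_comp, hf2, hv1, Category.assoc, hκ2, h21,
      comp_hzero, F.map_hzero]))
    (hfaith (by simp only [F.toFunctor.map_comp, hf2, hv2, Category.assoc, hκ2, h22, hψ]))
  have e1' : ∀ n, hStar θ ≫ F.toFunctor.map (ψh n) = t1 n ≫ hStar κ ≫ F.toFunctor.map τ :=
    fun n => by
      rw [← e1, F.toFunctor.map_comp, hf1]
      simp only [Category.assoc, hθ2]
  have e2' : ∀ n, thHom hB n ≫ F.toFunctor.map i2 = t2 n ≫ hStar κ ≫ F.toFunctor.map τ :=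
    fun n => by
      rw [← hθ2 (thHom hB n), ← hψ, Category.assoc, ← F.toFunctor.map_comp, ← e2,
        F.toFunctor.map_comp, hf2]
      simp only [Category.assoc, hθ2]
  choose x1 ex hx1 hex using hD
  obtain ⟨dh, hdh, -⟩ := homOfGens (M := F.toFunctor.obj P) (N := F.toFunctor.obj U)
    (F.toFunctor.obj P).gen Gen.self
    (fun i => sapp (hStar θ ≫ F.toFunctor.map (ψh i.1)) i.2 ⊔
      (F.toFunctor.map i2).1 (qact i.1 i.2))
    (fun z => x1 (κ.1 ((hStar (F.toFunctor.map τ)).1 z)) ⊔ (hStar (F.toFunctor.map i2)).1 z)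
    (by
      rintro ⟨n, b⟩ z
      dsimp only
      have k1 : sstar (hStar θ ≫ F.toFunctor.map (ψh n)) z =
          sstar (t1 n) (κ.1 ((hStar (F.toFunctor.map τ)).1 z)) := by
        rw [e1', sstar_comp, hStar_comp, hStar_hStar]; rfl
      have k2 : qip B n ((hStar (F.toFunctor.map i2)).1 z) =
          sstar (t2 n) (κ.1 ((hStar (F.toFunctor.map τ)).1 z)) := by
        rw [← thHom_star hB, ← sstar_comp, e2', sstar_comp, hStar_comp, hStar_hStar]; rfl
      rw [qip_sup_left, sapp_ip, k1, hx1, ← hStar_ip, qip_sup_right, qip_act_left, qip_act_left,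
        ← qmul_sup, ← qmul_sup, sup_assoc, sup_eq_right.2 ((hex _ n).trans k2.ge)])
  obtain ⟨δ, hδ⟩ := hfull dh
  have d1 : δ ≫ r1 = 𝟙 P := hfaith (by
    rw [F.toFunctor.map_comp, hδ, F.toFunctor.map_id]
    refine (F.toFunctor.obj P).gen.hom_ext ?_
    rintro ⟨n, b⟩
    have k := hdh (n, b)
    dsimp only at k ⊢
    rw [comp_app, k, hom_sup, ← sapp_comp, Category.assoc, ← F.toFunctor.map_comp, hr1, hψ,
      hθ2, ← comp_app, ← F.toFunctor.map_comp, hi1, F.map_hzero, hzero_app, thHom_app, sup_bot_eq]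
    rfl)
  have d2 : δ ≫ r2 = 𝟙 P := hfaith (by
    rw [F.toFunctor.map_comp, hδ, F.toFunctor.map_id]
    refine (F.toFunctor.obj P).gen.hom_ext ?_
    rintro ⟨n, b⟩
    have k := hdh (n, b)
    dsimp only at k ⊢
    rw [comp_app, k, hom_sup, ← sapp_comp, Category.assoc, ← F.toFunctor.map_comp, hr2,
      F.map_hzero, comp_hzero, sapp_zero, ← comp_app, ← F.toFunctor.map_comp, hi2,
      F.toFunctor.map_id, bot_sup_eq])
  apply gen_of_sSup
  intro p
  refine le_antisymm ?_ (sSup_le fun x hx => hx.2)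
  obtain ⟨T, E, hT, hE⟩ := hU (δ.1 p)
  rw [← comp_app, d1, id_app] at hT
  simp only [← comp_app δ r2, d2, id_app] at hE
  have hTp : (⨆ i ∈ T, (ψ i.1).1 i.2) ≤ p := by conv_rhs => rw [hT]
                                                exact le_sup_left
  have hEp : ∀ d ∈ E, v1.1 d ≤ p := fun d hd => by
    conv_rhs => rw [hT]
    exact le_sup_of_le_right (le_iSup₂_of_le d hd le_rfl)
  conv_lhs => rw [hT]
  refine sup_le (iSup₂_le fun i hi => le_sSup ⟨⟨i, rfl⟩, ?_⟩) (iSup₂_le fun d hd => ?_)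
  · exact (le_iSup₂_of_le (f := fun i (_ : i ∈ T) => (ψ i.1).1 i.2) i hi le_rfl).trans hTp
  · have hd' : v1.1 d ⊔ v2.1 d ≤ p := sup_le (hEp d hd) (hE d hd)
    obtain ⟨T', hT'⟩ := hS (w.1 d)
    rw [← hv12] at hT'
    refine le_sup_left.trans (hT'.le.trans (iSup₂_le fun i hi => le_sSup ⟨⟨i, rfl⟩, ?_⟩))
    exact ((le_iSup₂_of_le (f := fun i (_ : i ∈ T') => (ψ i.1).1 i.2) i hi le_rfl).trans
      hT'.ge).trans hd'

end MMain

section MFwd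
variable {A B : Type u} [InvQuantale A] [InvQuantale B]

theorem fwd_faithful (F : StarFunctor A B) (G : StarFunctor B A)
    (η : F.toFunctor ⋙ G.toFunctor ⟶ 𝟭 (HObj A)) (hη : ∀ M, IsUnitaryHom (η.app M))
    {M N : HObj A} {f g : M ⟶ N} (h : F.toFunctor.map f = F.toFunctor.map g) : f = g := by
  have h1 : η.app M ≫ f = η.app M ≫ g := by
    have a := η.naturality f
    have b := η.naturality g
    simp only [Functor.comp_map, Functor.id_map] at a b
    exact a.symm.trans ((by rw [h] : _ = _).trans b)
  have h2 := (hη M).2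
  calc f = (hStar (η.app M) ≫ η.app M) ≫ f := by rw [h2]; exact (Category.id_comp f).symm
    _ = (hStar (η.app M) ≫ η.app M) ≫ g := by rw [Category.assoc, h1, Category.assoc]
    _ = g := by rw [h2]; exact Category.id_comp g

theorem nat_conj (F : StarFunctor A B) (G : StarFunctor B A)
    (η : F.toFunctor ⋙ G.toFunctor ⟶ 𝟭 (HObj A)) (hη : ∀ M, IsUnitaryHom (η.app M))
    {M N : HObj A} (f : M ⟶ N) :
    G.toFunctor.map (F.toFunctor.map f) = η.app M ≫ f ≫ hStar (η.app N) := by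
  have a : G.toFunctor.map (F.toFunctor.map f) ≫ η.app N = η.app M ≫ f := η.naturality f
  have h := (hη N).1
  calc G.toFunctor.map (F.toFunctor.map f)
      = G.toFunctor.map (F.toFunctor.map f) ≫ (η.app N ≫ hStar (η.app N)) := by
        rw [h]; exact (Category.comp_id _).symm
    _ = (G.toFunctor.map (F.toFunctor.map f) ≫ η.app N) ≫ hStar (η.app N) :=
        (Category.assoc _ _ _).symm
    _ = (η.app M ≫ f) ≫ hStar (η.app N) := by rw [a]
    _ = _ := Category.assoc _ _ _

theorem fwd_full (F : StarFunctor A B) (G : StarFunctor B A)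
    (η : F.toFunctor ⋙ G.toFunctor ⟶ 𝟭 (HObj A)) (hη : ∀ M, IsUnitaryHom (η.app M))
    (ζ : G.toFunctor ⋙ F.toFunctor ⟶ 𝟭 (HObj B)) (hζ : ∀ M, IsUnitaryHom (ζ.app M))
    {M N : HObj A} (g : F.toFunctor.obj M ⟶ F.toFunctor.obj N) :
    ∃ f : M ⟶ N, F.toFunctor.map f = g := by
  refine ⟨hStar (η.app M) ≫ G.toFunctor.map g ≫ η.app N, ?_⟩
  apply fwd_faithful G F ζ hζ
  rw [nat_conj F G η hη]
  apply hom_ext'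
  intro m
  have h1 : ∀ z, (hStar (η.app M)).1 ((η.app M).1 z) = z := fun z =>
    congrArg (fun k => k.1 z) (hη M).1
  have h2 : ∀ z, (hStar (η.app N)).1 ((η.app N).1 z) = z := fun z =>
    congrArg (fun k => k.1 z) (hη N).1
  simp only [comp_app]
  exact (h2 _).trans (congrArg (G.toFunctor.map g).1 (h1 m))

theorem lmul_comp (hA : InvQuantale.MReg A) (a b : A) :
    lmulHom A hA (a * b) = lmulHom A hA b ≫ lmulHom A hA a :=
  hom_ext' fun (c : A) => InvQuantale.qmul_assoc a b c

theorem lmul_star (hA : InvQuantale.MReg A) (a : A) :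
    hStar (lmulHom A hA a) = lmulHom A hA (star a) :=
  hStar_eq fun (m n : A) => by
    show star (a * m) * n = star m * (star a * n)
    rw [InvQuantale.qstar_mul, InvQuantale.qmul_assoc]

theorem lmul_sSup (hA : InvQuantale.MReg A) (S : Set A) :
    lmulHom A hA (sSup S) = hSup (lmulHom A hA '' S) :=
  hom_ext' fun (c : A) => (InvQuantale.sSup_mul S c).trans
    (iSup_image (f := lmulHom A hA) (t := S)
      (g := fun f : selfObj A hA ⟶ selfObj A hA => f.1 c)).symm

theorem thHom_sSup (hA : InvQuantale.MReg A) {N : HObj A} (S : Set N.carrier) :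
    thHom hA (sSup S) = hSup (thHom hA '' S) :=
  hom_ext' fun (c : A) => (QMod.sSup_act S c).trans
    (iSup_image (f := thHom hA) (t := S) (g := fun f : selfObj A hA ⟶ N => f.1 c)).symm

theorem comp_hSup {M N K : HObj A} (f : M ⟶ N) (S : Set (N ⟶ K)) :
    f ≫ hSup S = hSup ((fun g => f ≫ g) '' S) :=
  hom_ext' fun m => by
    rw [comp_app, hSup_app, hSup_app, iSup_image]
    rfl

theorem th_lmul (hA : InvQuantale.MReg A) {N : HObj A} (n n' : N.carrier) :
    thHom hA n' ≫ hStar (thHom hA n) = lmulHom A hA (qip A n n') :=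
  sapp_ext fun b => by
    rw [sapp_comp, thHom_app]
    refine (thHom_star hA n (qact n' b)).trans ?_
    rw [qip_act_right]; rfl

/-- `A` as a Hilbert module over itself. -/
def selfHM (hA : InvQuantale.MReg A) : HilbMod A where
  carrier := A
  lat := inferInstance
  str := selfQHilb hA.2

/-- The bimodule `F(A)`. -/
def fBim (hA : InvQuantale.MReg A) (F : StarFunctor A B) : BimodObj A B where
  carrier := (F.toFunctor.obj (selfObj A hA)).carrier
  lact := fun a z => (F.toFunctor.map (lmulHom A hA a)).1 z
  bimod :=
    { lact_mul := fun a b m => by rw [lmul_comp, F.toFunctor.map_comp, comp_app]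
      sSup_lact := fun S m => by
        rw [lmul_sSup, F.map_hSup, hSup_app, iSup_image, iSup_image]
      lact_sSup := fun a S => hom_sSup _ S
      lact_act := fun a x b => hom_act _ x b
      ip_lact := fun a x y => by
        rw [← lmul_star, F.map_star, hStar_ip] }

theorem fwd_less (hA : InvQuantale.MReg A) (hB : InvQuantale.MReg B)
    (F : StarFunctor A B) (G : StarFunctor B A)
    (η : F.toFunctor ⋙ G.toFunctor ⟶ 𝟭 (HObj A)) (hη : ∀ M, IsUnitaryHom (η.app M))
    (ζ : G.toFunctor ⋙ F.toFunctor ⟶ 𝟭 (HObj B)) (hζ : ∀ M, IsUnitaryHom (ζ.app M)) :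
    LEssentialAct (fBim hA F).lact := by
  have hg := main_gen hB hA G (fun h => fwd_faithful G F ζ hζ h)
    (fun g => fwd_full G F ζ hζ η hη g) (fun D => ⟨F.toFunctor.obj D, η.app D, hη D⟩)
    (F.toFunctor.obj (selfObj A hA)) (F.toFunctor.obj (selfObj A hA))
    (η.app (selfObj A hA)) (hη _)
    (fun n => F.toFunctor.map (lmulHom A hA ((η.app (selfObj A hA)).1 n)))
    (fun n => by
      rw [nat_conj F G η hη]
      congr 1
      refine sapp_ext fun b => ?_
      have h1 : (hStar (η.app (selfObj A hA))).1 ((η.app (selfObj A hA)).1 n) = n :=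
        congrArg (fun k => k.1 n) (hη (selfObj A hA)).1
      rw [sapp_comp, thHom_app]
      refine (hom_act (hStar (η.app (selfObj A hA))) ((η.app (selfObj A hA)).1 n) b).trans ?_
      rw [h1])
  intro m
  refine le_antisymm ?_ (sSup_le fun x hx => hx.2)
  refine (hg.sSup_eq m).le.trans (sSup_le_sSup ?_)
  rintro x ⟨⟨i, rfl⟩, hx⟩
  exact ⟨⟨_, _, rfl⟩, hx⟩

theorem fwd_data (hA : InvQuantale.MReg A) (hB : InvQuantale.MReg B)
    (F : StarFunctor A B) (G : StarFunctor B A)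
    (η : F.toFunctor ⋙ G.toFunctor ⟶ 𝟭 (HObj A)) (hη : ∀ M, IsUnitaryHom (η.app M))
    (ζ : G.toFunctor ⋙ F.toFunctor ⟶ 𝟭 (HObj B)) (hζ : ∀ M, IsUnitaryHom (ζ.app M)) :
    ∃ (P : HilbMod A) (t : (fBim hA F).carrier → (fBim hB G).carrier → P.carrier)
           (lP : A → P.carrier → P.carrier) (Φ : P.carrier → A),
           IsInteriorTensor B A (fBim hB G).lact t ∧
           (∀ (a : A) (x : (fBim hA F).carrier) (y : (fBim hB G).carrier),
             lP a (t x y) = t ((fBim hA F).lact a x) y) ∧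
           Function.Bijective Φ ∧
           (∀ S : Set P.carrier, Φ (sSup S) = ⨆ p ∈ S, Φ p) ∧
           (∀ (a : A) (p : P.carrier), Φ (lP a p) = a * Φ p) ∧
           (∀ (p : P.carrier) (a : A), Φ (qact p a) = Φ p * a) ∧
           (∀ p q : P.carrier, qip A (Φ p) (Φ q) = qip A p q) := by
  have hfaith : ∀ {M N : HObj A} {f g : M ⟶ N},
    F.toFunctor.map f = F.toFunctor.map g → f = g := fun h => fwd_faithful F G η hη h
  let P : HObj A := selfObj A hA
  let Y : HObj A := G.toFunctor.obj (selfObj B hB)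
  let θ : F.toFunctor.obj Y ⟶ selfObj B hB := ζ.app (selfObj B hB)
  have hfull : ∀ x : (F.toFunctor.obj P).carrier, ∃ f : Y ⟶ P,
    F.toFunctor.map f = θ ≫ thHom hB x := fun x => fwd_full F G η hη ζ hζ _
  choose ψ hψ using hfull
  have hg := main_gen hA hB F hfaith
    (fun g => fwd_full F G η hη ζ hζ g) (fun D => ⟨G.toFunctor.obj D, ζ.app D, hζ D⟩)
    Y P θ (hζ _) ψ hψ
  have hip : ∀ x x', ψ x' ≫ hStar (ψ x) = G.toFunctor.map (lmulHom B hB (qip B x x')) := by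
    intro x x'
    apply hfaith
    rw [F.toFunctor.map_comp, F.map_star, hψ, hψ, hStar_comp, nat_conj G F ζ hζ, ← th_lmul]
    simp only [Category.assoc]
    rfl
  have hact : ∀ a x, ψ x ≫ lmulHom A hA a = ψ ((F.toFunctor.map (lmulHom A hA a)).1 x) := by
    intro a x
    apply hfaith
    rw [F.toFunctor.map_comp, hψ, hψ, Category.assoc, thHom_comp]
  have hsup : ∀ S : Set (F.toFunctor.obj P).carrier, ψ (sSup S) = hSup (ψ '' S) := by
    intro S
    apply hfaith
    rw [F.map_hSup, hψ, thHom_sSup, comp_hSup, Set.image_image, Set.image_image]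
    simp only [hψ]
  refine ⟨selfHM hA, fun x y => (ψ x).1 y, fun a (p : A) => a * p,
    fun p => p, ⟨?_, ?_, ?_, ?_⟩, ?_, Function.bijective_id, ?_, ?_, ?_, ?_⟩
  · intro x₁ x₂ y₁ y₂
    have h := hStar_ip (ψ x₁) y₁ ((ψ x₂).1 y₂)
    have h2 : (hStar (ψ x₁)).1 ((ψ x₂).1 y₂) =
        (G.toFunctor.map (lmulHom B hB (qip B x₁ x₂))).1 y₂ :=
      congrArg (fun k => k.1 y₂) (hip x₁ x₂)
    exact h.symm.trans (congrArg (fun z => qip A (M := Y.carrier) y₁ z) h2)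
  · intro S y
    have h := congrArg (fun k => k.1 y) (hsup S)
    exact h.trans ((hSup_app _ _).trans iSup_image)
  · intro x S
    exact hom_sSup (ψ x) S
  · intro p
    have h := hg.sSup_eq p
    simp only [Prod.exists] at h
    exact h
  · intro a x y
    exact congrArg (fun k => k.1 y) (hact a x)
  · intro S
    exact sSup_eq_iSup
  · intros; rfl
  · intros; rfl
  · intros; rfl

end MFwd


/-- **fundamental Morita theorem.** Two m-regular involutive quantales
`A` and `B` are Morita equivalent iff there are an essential right Hilbert `A`–`B`
bimodule `X` and an essential right Hilbert `B`–`A` bimodule `Y` with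
`X ⊗̇_B Y ≅ A` and `Y ⊗̇_A X ≅ B` as bimodules. -/
theorem morita_iff_inverse_bimodules (A B : Type u) [InvQuantale A] [InvQuantale B]
    (hA : InvQuantale.MReg A) (hB : InvQuantale.MReg B) :
    Morita A B ↔
      ∃ (X : BimodObj A B) (Y : BimodObj B A),
        LEssentialAct X.lact ∧ LEssentialAct Y.lact ∧
        (∃ (P : HilbMod A) (t : X.carrier → Y.carrier → P.carrier)
           (lP : A → P.carrier → P.carrier) (Φ : P.carrier → A),
           IsInteriorTensor B A Y.lact t ∧
           (∀ (a : A) (x : X.carrier) (y : Y.carrier), lP a (t x y) = t (X.lact a x) y) ∧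
           Function.Bijective Φ ∧
           (∀ S : Set P.carrier, Φ (sSup S) = ⨆ p ∈ S, Φ p) ∧
           (∀ (a : A) (p : P.carrier), Φ (lP a p) = a * Φ p) ∧
           (∀ (p : P.carrier) (a : A), Φ (qact p a) = Φ p * a) ∧
           (∀ p q : P.carrier, qip A (Φ p) (Φ q) = qip A p q)) ∧
        (∃ (Q : HilbMod B) (s : Y.carrier → X.carrier → Q.carrier)
           (lQ : B → Q.carrier → Q.carrier) (Ψ : Q.carrier → B),
           IsInteriorTensor A B X.lact s ∧
           (∀ (b : B) (y : Y.carrier) (x : X.carrier), lQ b (s y x) = s (Y.lact b y) x) ∧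
           Function.Bijective Ψ ∧
           (∀ S : Set Q.carrier, Ψ (sSup S) = ⨆ q ∈ S, Ψ q) ∧
           (∀ (b : B) (q : Q.carrier), Ψ (lQ b q) = b * Ψ q) ∧
           (∀ (q : Q.carrier) (b : B), Ψ (qact q b) = Ψ q * b) ∧
           (∀ p q : Q.carrier, qip B (Ψ p) (Ψ q) = qip B p q)) := by
  constructor
  · rintro ⟨F, G, η, ζ, hη, hζ⟩
    exact ⟨fBim hA F, fBim hB G, fwd_less hA hB F G η hη ζ hζ, fwd_less hB hA G F ζ hζ η hη,
      fwd_data hA hB F G η hη ζ hζ, fwd_data hB hA G F ζ hζ η hη⟩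
  · rintro ⟨X, Y, hX, hY, hP, hQ⟩
    obtain ⟨η, hη⟩ := counit_of_data hA hB X Y hY hP
    obtain ⟨ζ, hζ⟩ := counit_of_data hB hA Y X hX hQ
    exact ⟨tFun hB X, tFun hA Y, η, ζ, hη, hζ⟩
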